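/- arXiv:0911.3940 — 6 statements merged into one kernel-verified Lean document; each statement's English description precedes it below -/
import Mathlib

section
/- Let η : ℝ → ℝ be smooth and convex, let C ∈ ℝ, and let x_L : [t₀,T] → ℝ and x_R : [t₀,T] → ℝ be Lipschitz continuous functions with x_R(t) − x_L(t) ≥ δ for a fixed δ > 0 and all t ∈ [t₀,T]. Then for every entropy solution U of the conservation law admitting one-sided spatial limits and all a, b with t₀ ≤ a < b ≤ T: ∫_{x_L(b)}^{x_R(b)} η(U(x,b)|C) dx − ∫_{x_L(a)}^{x_R(a)} η(U(x,a)|C) dx ≤ ∫_a^b [F(U(x_L(t)+,t),C) − ẋ_L(t) η(U(x_L(t)+,t)|C)] dt − ∫_a^b [F(U(x_R(t)−,t),C) − ẋ_R(t) η(U(x_R(t)−,t)|C)] dt, where ẋ_L, ẋ_R denote the almost-everywhere defined derivatives of the Lipschitz functions x_L, x_R. -/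
open MeasureTheory Set Filter Topology

noncomputable section

/-- The Riemann data `φ` with left state `CL` and right state `CR`. -/
def riemann (CL CR : ℝ) (x : ℝ) : ℝ := if x < 0 then CL else CR

/-- The relative entropy `η(v | C) = η(v) - η(C) - η'(C)(v - C)`. -/
def relEnt (η : ℝ → ℝ) (v C : ℝ) : ℝ := η v - η C - deriv η C * (v - C)

/-- The relative entropy flux `F(v, C) = ∫_C^v (η'(w) - η'(C)) A'(w) dw`. -/
def relFlux (A η : ℝ → ℝ) (v C : ℝ) : ℝ := ∫ w in C..v, (deriv η w - deriv η C) * deriv A w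

/-- The normalized relative entropy flux `f(v, C) = F(v, C) / η(v | C)` for `v ≠ C`,
extended by `f(C, C) = A'(C)` on the diagonal. -/
def normFlux (A η : ℝ → ℝ) (v C : ℝ) : ℝ :=
  if v = C then deriv A C else relFlux A η v C / relEnt η v C

/-- `U` is a bounded measurable entropy solution of `∂ₜ U + ∂ₓ A(U) = 0` on `ℝ × (0, ∞)`:
for every entropy/entropy-flux pair `(η, G)` with `η'' ≥ 0` and `G' = η' A'`, and every
nonnegative smooth compactly supported test function `θ` vanishing for `t ≤ 0`, one has
`∫₀^∞ ∫_ℝ (η(U) ∂ₜθ + G(U) ∂ₓθ) dx dt ≥ 0`. -/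
structure IsEntropySol (A : ℝ → ℝ) (U : ℝ → ℝ → ℝ) : Prop where
  bounded : ∃ M, ∀ x t, |U x t| ≤ M
  measurable : Measurable fun p : ℝ × ℝ => U p.1 p.2
  entropy : ∀ η G : ℝ → ℝ, ContDiff ℝ (⊤ : ℕ∞) η → ContDiff ℝ (⊤ : ℕ∞) G →
    (∀ v, 0 ≤ deriv (deriv η) v) → (∀ v, deriv G v = deriv η v * deriv A v) →
    ∀ θ : ℝ → ℝ → ℝ, ContDiff ℝ (⊤ : ℕ∞) (fun p : ℝ × ℝ => θ p.1 p.2) →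
      HasCompactSupport (fun p : ℝ × ℝ => θ p.1 p.2) →
      (∀ x t, 0 ≤ θ x t) → (∀ x t, t ≤ 0 → θ x t = 0) →
      0 ≤ ∫ t in Ioi (0 : ℝ), ∫ x : ℝ,
        (η (U x t) * deriv (fun s => θ x s) t + G (U x t) * deriv (fun y => θ y t) x)

/-- `Um x t = U(x-, t)` and `Up x t = U(x+, t)` are the one-sided spatial limits of `U`,
satisfying `U(x-, t) ≥ U(x+, t)` for all `x` and all `t > 0`. -/
structure HasSideLimits (U Um Up : ℝ → ℝ → ℝ) : Prop where
  left : ∀ x t : ℝ, 0 < t → Tendsto (fun y => U y t) (𝓝[<] x) (𝓝 (Um x t))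
  right : ∀ x t : ℝ, 0 < t → Tendsto (fun y => U y t) (𝓝[>] x) (𝓝 (Up x t))
  mono : ∀ x t : ℝ, 0 < t → Up x t ≤ Um x t

/-- `t ↦ U(·, t)` is continuous from `[0, ∞)` into `L¹_loc(ℝ)`. -/
def L1locCont (U : ℝ → ℝ → ℝ) : Prop :=
  ∀ R > (0 : ℝ), ∀ t₀ ≥ (0 : ℝ),
    Tendsto (fun t => ∫ x in (-R)..R, |U x t - U x t₀|) (𝓝[≥] t₀) (𝓝 0)

/-- `x` is a Filippov solution on the set `s` of the differential inclusion
`ẋ(t) ∈ [f(U(x(t)+, t), C), f(U(x(t)-, t), C)]`, where `f` is the normalized relative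
entropy flux: `x` is Lipschitz on `s` and for a.e. `t ∈ s` it has a derivative lying
in the prescribed interval. -/
def IsFilippov (A η : ℝ → ℝ) (Um Up : ℝ → ℝ → ℝ) (C : ℝ) (s : Set ℝ) (x : ℝ → ℝ) : Prop :=
  (∃ K : NNReal, LipschitzOnWith K x s) ∧
  ∀ᵐ t ∂(volume.restrict s), ∃ d, HasDerivAt x d t ∧
    normFlux A η (Up (x t) t) C ≤ d ∧ d ≤ normFlux A η (Um (x t) t) C

lemma deriv_smoothTransition_nonneg (u : ℝ) : 0 ≤ deriv Real.smoothTransition u :=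
  Real.smoothTransition.monotone.deriv_nonneg

lemma deriv_smoothTransition_of_nonpos {u : ℝ} (hu : u ≤ 0) :
    deriv Real.smoothTransition u = 0 := by
  refine IsLocalMin.deriv_eq_zero (Eventually.of_forall fun v => ?_)
  rw [Real.smoothTransition.zero_of_nonpos hu]
  exact Real.smoothTransition.nonneg v

lemma deriv_smoothTransition_of_one_le {u : ℝ} (hu : 1 ≤ u) :
    deriv Real.smoothTransition u = 0 := by
  refine IsLocalMax.deriv_eq_zero (Eventually.of_forall fun v => ?_)
  rw [Real.smoothTransition.one_of_one_le hu]
  exact Real.smoothTransition.le_one v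

lemma continuous_deriv_smoothTransition : Continuous (deriv Real.smoothTransition) :=
  (Real.smoothTransition.contDiff (n := 1)).continuous_deriv le_rfl

lemma differentiable_smoothTransition : Differentiable ℝ Real.smoothTransition :=
  (Real.smoothTransition.contDiff (n := 1)).differentiable (by simp)

lemma hasCompactSupport_deriv_smoothTransition :
    HasCompactSupport (deriv Real.smoothTransition) := by
  refine HasCompactSupport.intro (isCompact_Icc (a := (0 : ℝ)) (b := 1)) fun u hu => ?_
  rcases le_or_gt u 0 with h | h
  · exact deriv_smoothTransition_of_nonpos h
  · exact deriv_smoothTransition_of_one_le (not_lt.1 fun h1 => hu ⟨h.le, h1.le⟩)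

lemma integrable_deriv_smoothTransition : Integrable (deriv Real.smoothTransition) :=
  continuous_deriv_smoothTransition.integrable_of_hasCompactSupport
    hasCompactSupport_deriv_smoothTransition

lemma integral_deriv_smoothTransition : ∫ u, deriv Real.smoothTransition u = 1 := by
  have h1 : ∫ u in (0 : ℝ)..1, deriv Real.smoothTransition u = 1 := by
    rw [intervalIntegral.integral_deriv_eq_sub (fun x _ => differentiable_smoothTransition x)
      (continuous_deriv_smoothTransition.intervalIntegrable _ _)]
    simp
  rw [← h1, intervalIntegral.integral_of_le zero_le_one]
  refine (setIntegral_eq_integral_of_forall_compl_eq_zero fun u hu => ?_).symm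
  rcases le_or_gt u 0 with h | h
  · exact deriv_smoothTransition_of_nonpos h
  · exact deriv_smoothTransition_of_one_le (not_lt.1 fun h1 => hu ⟨h, h1.le⟩)

/-- Average of `f` over `[x, x + ε]` with the smooth weight `deriv Real.smoothTransition`. -/
def smoothAvg (ε : ℝ) (f : ℝ → ℝ) (x : ℝ) : ℝ :=
  ∫ u, deriv Real.smoothTransition u * f (x + ε * u)

lemma tendsto_integral_deriv_smoothTransition_mul {ι : Type*} {l : Filter ι}
    [l.IsCountablyGenerated] {φ : ι → ℝ → ℝ} {L M : ℝ} (hφ : ∀ i, Measurable (φ i))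
    (hM : ∀ i u, |φ i u| ≤ M) (hlim : ∀ u ∈ Ioo (0 : ℝ) 1, Tendsto (fun i => φ i u) l (𝓝 L)) :
    Tendsto (fun i => ∫ u, deriv Real.smoothTransition u * φ i u) l (𝓝 L) := by
  have hL : L = ∫ u, deriv Real.smoothTransition u * L := by
    rw [integral_mul_const, integral_deriv_smoothTransition, one_mul]
  rw [hL]
  refine tendsto_integral_filter_of_dominated_convergence
    (fun u => deriv Real.smoothTransition u * M) (Eventually.of_forall fun i => ?_)
    (Eventually.of_forall fun i => Eventually.of_forall fun u => ?_)
    (integrable_deriv_smoothTransition.mul_const M) (Eventually.of_forall fun u => ?_)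
  · exact (continuous_deriv_smoothTransition.measurable.mul (hφ i)).aestronglyMeasurable
  · rw [norm_mul, Real.norm_eq_abs, Real.norm_eq_abs,
      abs_of_nonneg (deriv_smoothTransition_nonneg u)]
    exact mul_le_mul_of_nonneg_left (hM i u) (deriv_smoothTransition_nonneg u)
  · rcases le_or_gt u 0 with h | h
    · simpa [deriv_smoothTransition_of_nonpos h] using tendsto_const_nhds
    rcases le_or_gt 1 u with h1 | h1
    · simpa [deriv_smoothTransition_of_one_le h1] using tendsto_const_nhds
    exact (hlim u ⟨h, h1⟩).const_mul _

lemma abs_smoothAvg_le {f : ℝ → ℝ} {M : ℝ} (hM : ∀ x, |f x| ≤ M) (ε x : ℝ) :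
    |smoothAvg ε f x| ≤ M := by
  have hI : M = ∫ u, deriv Real.smoothTransition u * M := by
    rw [integral_mul_const, integral_deriv_smoothTransition, one_mul]
  rw [hI, smoothAvg, ← Real.norm_eq_abs]
  refine norm_integral_le_of_norm_le (integrable_deriv_smoothTransition.mul_const M)
    (Eventually.of_forall fun u => ?_)
  rw [norm_mul, Real.norm_eq_abs, Real.norm_eq_abs,
    abs_of_nonneg (deriv_smoothTransition_nonneg u)]
  exact mul_le_mul_of_nonneg_left (hM _) (deriv_smoothTransition_nonneg u)

lemma smoothAvg_eq_integral {ε : ℝ} (hε : 0 < ε) (f : ℝ → ℝ) (x : ℝ) :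
    smoothAvg ε f x = ∫ v, ε⁻¹ * deriv Real.smoothTransition ((v - x) / ε) * f v := by
  have h1 := Measure.integral_comp_div
    (fun u => deriv Real.smoothTransition u * f (x + ε * u)) ε
  have h2 := integral_sub_right_eq_self (μ := volume)
    (fun v => deriv Real.smoothTransition (v / ε) * f (x + ε * (v / ε))) x
  rw [smoothAvg]
  simp_rw [mul_assoc]
  rw [integral_const_mul]
  have h3 : (∫ v, deriv Real.smoothTransition ((v - x) / ε) * f v)
      = ∫ v, deriv Real.smoothTransition ((v - x) / ε) * f (x + ε * ((v - x) / ε)) := by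
    congr 1; ext v
    congr 2; field_simp; ring
  rw [h3, h2, h1, abs_of_pos hε, smul_eq_mul, inv_mul_cancel_left₀ hε.ne']

lemma integrable_kernel_mul {ε M : ℝ} (hε : 0 < ε) {f : ℝ → ℝ} (hf : Measurable f)
    (hM : ∀ x, |f x| ≤ M) (x : ℝ) :
    Integrable fun v => ε⁻¹ * deriv Real.smoothTransition ((v - x) / ε) * f v :=
  (((integrable_deriv_smoothTransition.comp_div hε.ne').comp_sub_right x).const_mul ε⁻¹).mul_bdd
    hf.aestronglyMeasurable (Eventually.of_forall hM)

lemma measurable_smoothAvg {g : ℝ → ℝ → ℝ} (hg : Measurable fun p : ℝ × ℝ => g p.1 p.2)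
    {y : ℝ → ℝ} (hy : Measurable y) (ε : ℝ) :
    Measurable fun t => smoothAvg ε (fun x => g x t) (y t) := by
  have h : Measurable fun p : ℝ × ℝ =>
      deriv Real.smoothTransition p.2 * g (y p.1 + ε * p.2) p.1 := by
    refine (continuous_deriv_smoothTransition.measurable.comp measurable_snd).mul ?_
    exact hg.comp (((hy.comp measurable_fst).add (measurable_snd.const_mul ε)).prodMk
      measurable_fst)
  exact h.stronglyMeasurable.integral_prod_right.measurable

lemma continuous_smoothAvg {ε M : ℝ} (hε : 0 < ε) {f : ℝ → ℝ} (hf : Measurable f)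
    (hM : ∀ x, |f x| ≤ M) : Continuous (smoothAvg ε f) := by
  have hM0 : 0 ≤ M := (abs_nonneg _).trans (hM 0)
  obtain ⟨B, hB⟩ := hasCompactSupport_deriv_smoothTransition.exists_bound_of_continuous
    continuous_deriv_smoothTransition
  have hB0 : 0 ≤ B := (norm_nonneg _).trans (hB 0)
  rw [continuous_iff_continuousAt]
  intro x
  simp only [ContinuousAt, funext fun x => smoothAvg_eq_integral hε f x]
  refine tendsto_integral_filter_of_dominated_convergence
    ((Icc (x - 1) (x + 1 + ε)).indicator fun _ => ε⁻¹ * B * M)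
    (Eventually.of_forall fun z => (integrable_kernel_mul hε hf hM z).aestronglyMeasurable)
    ?_ ?_ (Eventually.of_forall fun v => ?_)
  · filter_upwards [Ioo_mem_nhds (sub_one_lt x) (lt_add_one x)] with z hz
    refine Eventually.of_forall fun v => ?_
    by_cases hv : v ∈ Icc (x - 1) (x + 1 + ε)
    · rw [indicator_of_mem hv, norm_mul, norm_mul, Real.norm_of_nonneg (inv_nonneg.2 hε.le)]
      gcongr
      · exact hB _
      · exact hM v
    · rw [indicator_of_notMem hv]
      have : deriv Real.smoothTransition ((v - z) / ε) = 0 := by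
        rcases le_or_gt v z with h | h
        · exact deriv_smoothTransition_of_nonpos
            (div_nonpos_of_nonpos_of_nonneg (by linarith) hε.le)
        · refine deriv_smoothTransition_of_one_le ((one_le_div hε).2 ?_)
          by_contra h1
          exact hv ⟨by linarith [hz.1], by linarith [hz.2]⟩
      simp [this]
  · exact (integrableOn_const (by simp)).integrable_indicator measurableSet_Icc
  · have h1 : Continuous fun z => ε⁻¹ * deriv Real.smoothTransition ((v - z) / ε) * f v := by
      have := continuous_deriv_smoothTransition
      fun_prop
    exact h1.tendsto x

/-- A smooth approximation of the indicator of `[y, z]`, with transition layers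
`[y, y + ε]` and `[z, z + ε]`. -/
def smoothWindow (ε y z x : ℝ) : ℝ :=
  Real.smoothTransition ((x - y) / ε) - Real.smoothTransition ((x - z) / ε)

lemma smoothWindow_nonneg {ε y z : ℝ} (hε : 0 < ε) (hyz : y ≤ z) (x : ℝ) :
    0 ≤ smoothWindow ε y z x :=
  sub_nonneg.2 (Real.smoothTransition.monotone (by gcongr))

lemma abs_smoothWindow_le_one (ε y z x : ℝ) : |smoothWindow ε y z x| ≤ 1 := by
  have h1 := Real.smoothTransition.nonneg ((x - y) / ε)
  have h2 := Real.smoothTransition.le_one ((x - y) / ε)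
  have h3 := Real.smoothTransition.nonneg ((x - z) / ε)
  have h4 := Real.smoothTransition.le_one ((x - z) / ε)
  rw [smoothWindow, abs_le]
  constructor <;> linarith

lemma smoothWindow_eq_zero {ε y z R x : ℝ} (hε : 0 < ε) (hy : y ∈ Icc (-R) (R - ε))
    (hz : z ∈ Icc (-R) (R - ε)) (hx : x ∉ Icc (-R) R) : smoothWindow ε y z x = 0 := by
  rcases lt_or_ge x (-R) with h | h
  · rw [smoothWindow, Real.smoothTransition.zero_of_nonpos,
      Real.smoothTransition.zero_of_nonpos, sub_zero] <;>
    exact div_nonpos_of_nonpos_of_nonneg (by linarith [hy.1, hz.1]) hε.le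
  · have hR : R < x := not_le.1 fun h1 => hx ⟨h, h1⟩
    rw [smoothWindow, Real.smoothTransition.one_of_one_le,
      Real.smoothTransition.one_of_one_le, sub_self] <;>
    exact (one_le_div hε).2 (by linarith [hy.2, hz.2])

lemma smoothWindow_eq_zero_of_notMem_Ioo {ε y z x : ℝ} (hε : 0 < ε) (hyz : y ≤ z)
    (hx : x ∉ Ioo y (z + ε)) : smoothWindow ε y z x = 0 := by
  rcases le_or_gt x y with h | h
  · rw [smoothWindow, Real.smoothTransition.zero_of_nonpos,
      Real.smoothTransition.zero_of_nonpos, sub_zero] <;>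
    exact div_nonpos_of_nonpos_of_nonneg (by linarith) hε.le
  · have h' : z + ε ≤ x := not_lt.1 fun h' => hx ⟨h, h'⟩
    rw [smoothWindow, Real.smoothTransition.one_of_one_le,
      Real.smoothTransition.one_of_one_le, sub_self] <;>
    exact (one_le_div hε).2 (by linarith)

lemma continuous_smoothWindow (ε y z : ℝ) : Continuous (smoothWindow ε y z) := by
  have := Real.smoothTransition.continuous
  unfold smoothWindow
  fun_prop

lemma abs_mul_smoothWindow_le {ε y z R M v : ℝ} (hε : 0 < ε) (hy : y ∈ Icc (-R) (R - ε))
    (hz : z ∈ Icc (-R) (R - ε)) (hv : |v| ≤ M) (x : ℝ) :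
    |v * smoothWindow ε y z x| ≤ (Icc (-R) R).indicator (fun _ => M) x := by
  by_cases hx : x ∈ Icc (-R) R
  · rw [indicator_of_mem hx, abs_mul]
    calc |v| * |smoothWindow ε y z x| ≤ |v| * 1 := by
          gcongr; exact abs_smoothWindow_le_one _ _ _ _
      _ ≤ M := by rwa [mul_one]
  · rw [indicator_of_notMem hx, smoothWindow_eq_zero hε hy hz hx, mul_zero, abs_zero]

lemma integrable_indicator_Icc_const (R M : ℝ) :
    Integrable ((Icc (-R) R).indicator fun _ => M) :=
  (integrableOn_const (by simp)).integrable_indicator measurableSet_Icc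

lemma exists_mem_Icc_neg_sub (ε y z : ℝ) :
    ∃ R, y ∈ Icc (-R) (R - ε) ∧ z ∈ Icc (-R) (R - ε) := by
  refine ⟨|y| + |z| + |ε|, ⟨?_, ?_⟩, ⟨?_, ?_⟩⟩ <;>
  linarith [neg_abs_le y, neg_abs_le z, le_abs_self y, le_abs_self z, le_abs_self ε,
    abs_nonneg y, abs_nonneg z, abs_nonneg ε]

lemma integrable_mul_smoothWindow {f : ℝ → ℝ} {M ε : ℝ} (hf : Measurable f)
    (hM : ∀ x, |f x| ≤ M) (hε : 0 < ε) (y z : ℝ) :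
    Integrable fun x => f x * smoothWindow ε y z x := by
  obtain ⟨R, hy, hz⟩ := exists_mem_Icc_neg_sub ε y z
  refine (integrable_indicator_Icc_const R M).mono'
    (hf.mul (continuous_smoothWindow ε y z).measurable).aestronglyMeasurable
    (Eventually.of_forall fun x => abs_mul_smoothWindow_le hε hy hz (hM x) x)

lemma tendsto_integral_mul_smoothWindow {ι : Type*} {l : Filter ι} [l.IsCountablyGenerated]
    {f w : ℝ → ℝ} {M R : ℝ} {ε y z : ι → ℝ} (hf : Measurable f) (hM : ∀ x, |f x| ≤ M)
    (hε : ∀ᶠ i in l, 0 < ε i) (hy : ∀ᶠ i in l, y i ∈ Icc (-R) (R - ε i))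
    (hz : ∀ᶠ i in l, z i ∈ Icc (-R) (R - ε i))
    (hw : ∀ᵐ x, Tendsto (fun i => smoothWindow (ε i) (y i) (z i) x) l (𝓝 (w x))) :
    Tendsto (fun i => ∫ x, f x * smoothWindow (ε i) (y i) (z i) x) l
      (𝓝 (∫ x, f x * w x)) := by
  refine tendsto_integral_filter_of_dominated_convergence _
    (Eventually.of_forall fun i =>
      (hf.mul (continuous_smoothWindow _ _ _).measurable).aestronglyMeasurable) ?_
    (integrable_indicator_Icc_const R M) ?_
  · filter_upwards [hε, hy, hz] with i h1 h2 h3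
    exact Eventually.of_forall fun x => abs_mul_smoothWindow_le h1 h2 h3 (hM x) x
  · filter_upwards [hw] with x hx using hx.const_mul _

lemma tendsto_integral_mul_smoothWindow_of_tendsto {ι : Type*} {l : Filter ι}
    [l.IsCountablyGenerated] {f : ℝ → ℝ} {M ε y₀ z₀ : ℝ} {y z : ι → ℝ} (hf : Measurable f)
    (hM : ∀ x, |f x| ≤ M) (hε : 0 < ε) (hy : Tendsto y l (𝓝 y₀)) (hz : Tendsto z l (𝓝 z₀)) :
    Tendsto (fun i => ∫ x, f x * smoothWindow ε (y i) (z i) x) l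
      (𝓝 (∫ x, f x * smoothWindow ε y₀ z₀ x)) := by
  obtain ⟨R, hR, hR'⟩ := exists_mem_Icc_neg_sub (ε + 1) y₀ z₀
  have key : ∀ {v₀ : ℝ} {v : ι → ℝ}, v₀ ∈ Icc (-R) (R - (ε + 1)) → Tendsto v l (𝓝 v₀) →
      ∀ᶠ i in l, v i ∈ Icc (-(R + 1)) (R + 1 - ε) := fun {v₀ v} h hv => by
    filter_upwards [hv (Ioo_mem_nhds (sub_one_lt v₀) (lt_add_one v₀))] with i hi
    have hi' : v i ∈ Ioo (v₀ - 1) (v₀ + 1) := hi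
    exact ⟨by linarith [hi'.1, h.1], by linarith [hi'.2, h.2]⟩
  refine tendsto_integral_mul_smoothWindow (ε := fun _ => ε) hf hM (Eventually.of_forall fun _ => hε)
    (key hR hy) (key hR' hz) (Eventually.of_forall fun x => ?_)
  have hs := Real.smoothTransition.continuous
  exact ((hs.tendsto _).comp ((hy.const_sub x).div_const ε)).sub
    ((hs.tendsto _).comp ((hz.const_sub x).div_const ε))

lemma tendsto_integral_smoothWindow_nhdsGE {e : ℝ → ℝ → ℝ} {M ε a : ℝ}
    (he : Measurable fun p : ℝ × ℝ => e p.1 p.2) (hM : ∀ x t, |e x t| ≤ M) (hec : L1locCont e)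
    (ha : 0 ≤ a) (hε : 0 < ε) {y z : ℝ → ℝ} (hy : Continuous y) (hz : Continuous z) :
    Tendsto (fun t => ∫ x, e x t * smoothWindow ε (y t) (z t) x) (𝓝[≥] a)
      (𝓝 (∫ x, e x a * smoothWindow ε (y a) (z a) x)) := by
  have hm : ∀ t, Measurable fun x => e x t := fun t => he.comp (measurable_id.prodMk measurable_const)
  obtain ⟨R, hR, hR'⟩ := exists_mem_Icc_neg_sub (ε + 1) (y a) (z a)
  have key : ∀ {v : ℝ → ℝ}, v a ∈ Icc (-R) (R - (ε + 1)) → Continuous v →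
      ∀ᶠ t in 𝓝[≥] a, v t ∈ Icc (-(R + 1)) (R + 1 - ε) := fun {v} h hv => by
    filter_upwards [nhdsWithin_le_nhds ((hv.tendsto a)
      (Ioo_mem_nhds (sub_one_lt (v a)) (lt_add_one (v a))))] with t hi
    have hi' : v t ∈ Ioo (v a - 1) (v a + 1) := hi
    exact ⟨by linarith [hi'.1, h.1], by linarith [hi'.2, h.2]⟩
  have hR0 : 0 < R + 1 := by linarith [hR.1, hR.2]
  have h1 := tendsto_integral_mul_smoothWindow_of_tendsto (hm a) (hM · a) hε
    ((hy.tendsto a).mono_left (nhdsWithin_le_nhds (s := Ici a)))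
    ((hz.tendsto a).mono_left (nhdsWithin_le_nhds (s := Ici a)))
  have h2 : Tendsto (fun t => ∫ x, (e x t - e x a) * smoothWindow ε (y t) (z t) x)
      (𝓝[≥] a) (𝓝 0) := by
    refine squeeze_zero_norm' ?_ (hec (R + 1) hR0 a ha)
    filter_upwards [key hR hy, key hR' hz] with t hty htz
    have hsub : ∀ x, |e x t - e x a| ≤ M + M := fun x =>
      (abs_sub _ _).trans (add_le_add (hM x t) (hM x a))
    rw [intervalIntegral.integral_of_le (by linarith), ← integral_Icc_eq_integral_Ioc,
      ← integral_indicator measurableSet_Icc]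
    refine norm_integral_le_of_norm_le ?_ (Eventually.of_forall fun x => ?_)
    · refine (integrable_indicator_Icc_const (R + 1) (M + M)).mono'
        ((((hm t).sub (hm a)).abs.indicator measurableSet_Icc).aestronglyMeasurable)
        (Eventually.of_forall fun x => ?_)
      rw [norm_indicator_eq_indicator_norm]
      refine indicator_le_indicator ?_
      simpa using hsub x
    · have := abs_mul_smoothWindow_le hε hty htz (le_refl |e x t - e x a|) x
      refine this.trans (le_of_eq ?_)
      simp only [indicator]
  have h3 := h1.add h2
  rw [add_zero] at h3
  refine h3.congr fun t => ?_
  rw [← integral_add (integrable_mul_smoothWindow (hm a) (hM · a) hε _ _)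
    (integrable_mul_smoothWindow (f := fun x => e x t - e x a) ((hm t).sub (hm a)) (M := M + M) (fun x =>
      (abs_sub _ _).trans (add_le_add (hM x t) (hM x a))) hε _ _)]
  congr 1; ext x; ring

/-- Flux minus entropy transport through the moving curve `y` with speed `d`, averaged over
the layer `[y, y + ε]`. -/
def smoothCurveFlux (e g : ℝ → ℝ → ℝ) (ε : ℝ) (y d : ℝ → ℝ) (t : ℝ) : ℝ :=
  smoothAvg ε (fun x => g x t) (y t) - d t * smoothAvg ε (fun x => e x t) (y t)

lemma hasDerivAt_smoothWindow (ε y z x : ℝ) :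
    HasDerivAt (smoothWindow ε y z)
      (ε⁻¹ * deriv Real.smoothTransition ((x - y) / ε)
        - ε⁻¹ * deriv Real.smoothTransition ((x - z) / ε)) x := by
  have key : ∀ y, HasDerivAt (fun x => Real.smoothTransition ((x - y) / ε))
      (ε⁻¹ * deriv Real.smoothTransition ((x - y) / ε)) x := fun y => by
    have h1 : HasDerivAt (fun x => (x - y) / ε) (1 / ε) x :=
      ((hasDerivAt_id x).sub_const y).div_const ε
    have h2 := (differentiable_smoothTransition ((x - y) / ε)).hasDerivAt.comp x h1
    rwa [one_div, mul_comm] at h2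
  exact (key y).sub (key z)

lemma hasDerivAt_smoothWindow_curve (ε x : ℝ) {y z : ℝ → ℝ} {t y' z' : ℝ}
    (hy : HasDerivAt y y' t) (hz : HasDerivAt z z' t) :
    HasDerivAt (fun t => smoothWindow ε (y t) (z t) x)
      (z' * (ε⁻¹ * deriv Real.smoothTransition ((x - z t) / ε))
        - y' * (ε⁻¹ * deriv Real.smoothTransition ((x - y t) / ε))) t := by
  have key : ∀ {y : ℝ → ℝ} {y' : ℝ}, HasDerivAt y y' t →
      HasDerivAt (fun t => Real.smoothTransition ((x - y t) / ε))
      (-(y' * (ε⁻¹ * deriv Real.smoothTransition ((x - y t) / ε)))) t := fun {y y'} hy => by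
    have h1 : HasDerivAt (fun t => (x - y t) / ε) (-y' / ε) t := (hy.const_sub x).div_const ε
    have h2 := (differentiable_smoothTransition ((x - y t) / ε)).hasDerivAt.comp t h1
    exact h2.congr_deriv (by ring)
  exact ((key hy).sub (key hz)).congr_deriv (by ring)

lemma integral_entropy_smoothWindow {e g : ℝ → ℝ → ℝ} {M ε : ℝ}
    (he : Measurable fun p : ℝ × ℝ => e p.1 p.2) (hg : Measurable fun p : ℝ × ℝ => g p.1 p.2)
    (heM : ∀ x t, |e x t| ≤ M) (hgM : ∀ x t, |g x t| ≤ M) (hε : 0 < ε) {y z χ : ℝ → ℝ}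
    (hy : Differentiable ℝ y) (hz : Differentiable ℝ z) (hχ : Differentiable ℝ χ) (t : ℝ) :
    ∫ x, (e x t * deriv (fun s => χ s * smoothWindow ε (y s) (z s) x) t
        + g x t * deriv (fun v => χ t * smoothWindow ε (y t) (z t) v) x)
      = deriv χ t * (∫ x, e x t * smoothWindow ε (y t) (z t) x)
        + χ t * (smoothCurveFlux e g ε y (deriv y) t - smoothCurveFlux e g ε z (deriv z) t) := by
  have hm : ∀ {f : ℝ → ℝ → ℝ}, (Measurable fun p : ℝ × ℝ => f p.1 p.2) →
      Measurable fun x => f x t := fun hf => hf.comp (measurable_id.prodMk measurable_const)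
  have i₀ := integrable_mul_smoothWindow (hm he) (heM · t) hε (y t) (z t)
  have i₁ := integrable_kernel_mul hε (hm hg) (hgM · t) (y t)
  have i₂ := integrable_kernel_mul hε (hm hg) (hgM · t) (z t)
  have i₃ := integrable_kernel_mul hε (hm he) (heM · t) (y t)
  have i₄ := integrable_kernel_mul hε (hm he) (heM · t) (z t)
  have j₁ := i₁.sub (i₃.const_mul (deriv y t))
  have j₂ := i₂.sub (i₄.const_mul (deriv z t))
  have key := integral_add (i₀.const_mul (deriv χ t)) ((j₁.sub j₂).const_mul (χ t))
  simp only [smoothCurveFlux, smoothAvg_eq_integral hε]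
  have k := integral_sub j₁ j₂
  simp only [Pi.sub_apply] at k key
  rw [integral_const_mul, integral_const_mul, k, integral_sub i₁ (i₃.const_mul _),
    integral_sub i₂ (i₄.const_mul _), integral_const_mul, integral_const_mul] at key
  rw [← key]
  congr 1
  ext x
  rw [((hχ t).hasDerivAt.fun_mul (hasDerivAt_smoothWindow_curve ε x (hy t).hasDerivAt
    (hz t).hasDerivAt)).deriv, ((hasDerivAt_smoothWindow ε (y t) (z t) x).const_mul (χ t)).deriv]
  ring

lemma tendsto_smoothAvg_nhdsGT {f : ℝ → ℝ} {M L x : ℝ} (hf : Measurable f)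
    (hM : ∀ x, |f x| ≤ M) (hlim : Tendsto f (𝓝[>] x) (𝓝 L)) :
    Tendsto (fun ε => smoothAvg ε f x) (𝓝[>] 0) (𝓝 L) := by
  refine tendsto_integral_deriv_smoothTransition_mul
    (fun ε => hf.comp ((measurable_id.const_mul ε).const_add x)) (fun ε u => hM _) fun u hu => ?_
  refine hlim.comp (tendsto_nhdsWithin_iff.2 ⟨?_, ?_⟩)
  · have h : Continuous fun ε : ℝ => x + ε * u := by fun_prop
    have h0 := (h.tendsto 0).mono_left (nhdsWithin_le_nhds (s := Ioi 0))
    simpa using h0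
  · filter_upwards [self_mem_nhdsWithin] with ε hε
    have : 0 < ε * u := mul_pos hε hu.1
    exact lt_add_of_pos_right x this

lemma tendsto_smoothAvg_sub_nhdsLT {f : ℝ → ℝ} {M L x : ℝ} (hf : Measurable f)
    (hM : ∀ x, |f x| ≤ M) (hlim : Tendsto f (𝓝[<] x) (𝓝 L)) :
    Tendsto (fun ε => smoothAvg ε f (x - ε)) (𝓝[>] 0) (𝓝 L) := by
  refine tendsto_integral_deriv_smoothTransition_mul
    (fun ε => hf.comp ((measurable_id.const_mul ε).const_add (x - ε))) (fun ε u => hM _)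
    fun u hu => ?_
  refine hlim.comp (tendsto_nhdsWithin_iff.2 ⟨?_, ?_⟩)
  · have h : Continuous fun ε : ℝ => x - ε + ε * u := by fun_prop
    have h0 := (h.tendsto 0).mono_left (nhdsWithin_le_nhds (s := Ioi 0))
    simpa using h0
  · filter_upwards [self_mem_nhdsWithin] with ε hε
    have : 0 < ε * (1 - u) := mul_pos hε (sub_pos.2 hu.2)
    show x - ε + ε * u < x
    linarith

lemma tendsto_smoothTransition_div_of_pos {v : ℝ} (hv : 0 < v) :
    Tendsto (fun ε => Real.smoothTransition (v / ε)) (𝓝[>] 0) (𝓝 1) := by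
  refine tendsto_const_nhds.congr' ?_
  filter_upwards [Ioo_mem_nhdsGT hv] with ε hε
  exact (Real.smoothTransition.one_of_one_le ((one_le_div hε.1).2 hε.2.le)).symm

lemma tendsto_smoothTransition_div_of_nonpos {v : ℝ} (hv : v ≤ 0) :
    Tendsto (fun ε => Real.smoothTransition (v / ε)) (𝓝[>] 0) (𝓝 0) := by
  refine tendsto_const_nhds.congr' ?_
  filter_upwards [self_mem_nhdsWithin] with ε hε
  exact (Real.smoothTransition.zero_of_nonpos
    (div_nonpos_of_nonpos_of_nonneg hv (le_of_lt hε))).symm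

lemma tendsto_smoothWindow {y z : ℝ} (hyz : y ≤ z) (x : ℝ) :
    Tendsto (fun ε => smoothWindow ε y z x) (𝓝[>] 0)
      (𝓝 ((Ioc y z).indicator (fun _ => 1) x)) := by
  rcases le_or_gt x y with h | h
  · rw [indicator_of_notMem fun hx => not_lt.2 h hx.1]
    simpa [smoothWindow] using (tendsto_smoothTransition_div_of_nonpos (sub_nonpos.2 h)).sub
      (tendsto_smoothTransition_div_of_nonpos (sub_nonpos.2 (h.trans hyz)))
  rcases le_or_gt x z with h' | h'
  · rw [indicator_of_mem (show x ∈ Ioc y z from ⟨h, h'⟩)]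
    simpa [smoothWindow] using (tendsto_smoothTransition_div_of_pos (sub_pos.2 h)).sub
      (tendsto_smoothTransition_div_of_nonpos (sub_nonpos.2 h'))
  · rw [indicator_of_notMem fun hx => not_lt.2 hx.2 h']
    simpa [smoothWindow] using (tendsto_smoothTransition_div_of_pos (sub_pos.2 h)).sub
      (tendsto_smoothTransition_div_of_pos (sub_pos.2 h'))

lemma tendsto_smoothWindow_sub {y z : ℝ} (hyz : y < z) (x : ℝ) :
    Tendsto (fun ε => smoothWindow ε y (z - ε) x) (𝓝[>] 0)
      (𝓝 ((Ioo y z).indicator (fun _ => 1) x)) := by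
  have hone : ∀ᶠ ε : ℝ in 𝓝[>] 0, z ≤ x → Real.smoothTransition ((x - (z - ε)) / ε) = 1 := by
    filter_upwards [self_mem_nhdsWithin] with ε hε hx
    exact Real.smoothTransition.one_of_one_le ((one_le_div hε).2 (by linarith))
  have hzero : ∀ᶠ ε : ℝ in 𝓝[>] 0, x < z → Real.smoothTransition ((x - (z - ε)) / ε) = 0 := by
    by_cases hx : x < z
    · filter_upwards [Ioo_mem_nhdsGT (sub_pos.2 hx)] with ε hε _
      exact Real.smoothTransition.zero_of_nonpos
        (div_nonpos_of_nonpos_of_nonneg (by linarith [hε.2]) hε.1.le)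
    · exact Eventually.of_forall fun ε h => absurd h hx
  rcases le_or_gt z x with h | h
  · rw [indicator_of_notMem fun hx => not_le.2 hx.2 h]
    have h1 := (tendsto_smoothTransition_div_of_pos (sub_pos.2 (hyz.trans_le h))).sub
      (tendsto_const_nhds (x := (1 : ℝ)))
    rw [sub_self] at h1
    refine h1.congr' ?_
    filter_upwards [hone] with ε hε
    rw [smoothWindow, hε h]
  · have h2 : (fun ε => Real.smoothTransition ((x - y) / ε)) =ᶠ[𝓝[>] 0]
        fun ε => smoothWindow ε y (z - ε) x := by
      filter_upwards [hzero] with ε hε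
      rw [smoothWindow, hε h, sub_zero]
    refine Tendsto.congr' h2 ?_
    rcases le_or_gt x y with h' | h'
    · rw [indicator_of_notMem fun hx => not_lt.2 h' hx.1]
      exact tendsto_smoothTransition_div_of_nonpos (sub_nonpos.2 h')
    · have hxy : 0 < x - y := sub_pos.2 h'
      rw [indicator_of_mem (show x ∈ Ioo y z from ⟨h', h⟩)]
      exact tendsto_smoothTransition_div_of_pos hxy

/-- Integrating a differential inequality in time that holds against smooth approximations of
indicator functions. -/
lemma sub_le_integral_of_smoothWindow {E D : ℝ → ℝ} {a b τ M : ℝ} (ha : 0 ≤ a) (hab : a < b)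
    (hτ : 0 < τ) (hE : Measurable E) (hD : Measurable D)
    (hEM : ∀ t ∈ Icc a (b + τ), |E t| ≤ M) (hDM : ∀ t ∈ Icc a (b + τ), |D t| ≤ M)
    (hEa : Tendsto E (𝓝[≥] a) (𝓝 (E a))) (hEb : Tendsto E (𝓝[≥] b) (𝓝 (E b)))
    (h : ∀ ε ∈ Ioo 0 τ, 0 ≤ ∫ t in Ioi (0 : ℝ),
      (deriv (smoothWindow ε a b) t * E t + smoothWindow ε a b t * D t)) :
    E b - E a ≤ ∫ t in a..b, D t := by
  have hM : 0 ≤ M := (abs_nonneg _).trans (hEM a ⟨le_rfl, by linarith⟩)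
  set I := Icc a (b + τ) with hI
  have hbd : ∀ {F : ℝ → ℝ}, (∀ t ∈ I, |F t| ≤ M) → ∀ t, |I.indicator F t| ≤ M :=
    fun {F} hF t => by
      by_cases ht : t ∈ I
      · rw [indicator_of_mem ht]; exact hF t ht
      · rw [indicator_of_notMem ht, abs_zero]; exact hM
  have hmE : Measurable (I.indicator E) := hE.indicator measurableSet_Icc
  have hmD : Measurable (I.indicator D) := hD.indicator measurableSet_Icc
  have hside : ∀ c, a ≤ c → c < b + τ → Tendsto E (𝓝[≥] c) (𝓝 (E c)) →
      Tendsto (fun ε => smoothAvg ε (I.indicator E) c) (𝓝[>] 0) (𝓝 (E c)) := fun c hc hc' hlim => by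
    refine tendsto_smoothAvg_nhdsGT hmE (hbd hEM) ?_
    refine (hlim.mono_left (nhdsWithin_mono c Ioi_subset_Ici_self)).congr' ?_
    filter_upwards [Ioo_mem_nhdsGT hc'] with t ht
    rw [indicator_of_mem (show t ∈ I from ⟨hc.trans ht.1.le, ht.2.le⟩)]
  have hmid : Tendsto (fun ε => ∫ t, I.indicator D t * smoothWindow ε a b t) (𝓝[>] 0)
      (𝓝 (∫ t in a..b, D t)) := by
    have h1 := tendsto_integral_mul_smoothWindow (l := 𝓝[>] (0 : ℝ)) (ε := fun ε => ε)
      (y := fun _ => a) (z := fun _ => b) (R := |a| + |b| + 1)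
      (w := (Ioc a b).indicator fun _ => 1) hmD (hbd hDM) self_mem_nhdsWithin ?_ ?_
      (Eventually.of_forall fun t => tendsto_smoothWindow hab.le t)
    · convert h1 using 2
      rw [intervalIntegral.integral_of_le hab.le, ← integral_indicator measurableSet_Ioc]
      congr 1; ext t
      by_cases ht : t ∈ Ioc a b
      · rw [indicator_of_mem ht, indicator_of_mem ht, mul_one,
          indicator_of_mem (show t ∈ I from ⟨ht.1.le, ht.2.trans (by linarith)⟩)]
      · rw [indicator_of_notMem ht, indicator_of_notMem ht, mul_zero]
    all_goals
      filter_upwards [Ioo_mem_nhdsGT zero_lt_one] with ε hε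
      constructor <;> linarith [hε.2, neg_abs_le a, neg_abs_le b, le_abs_self a, le_abs_self b,
        abs_nonneg a, abs_nonneg b]
  have hlim := ((hside a le_rfl (by linarith) hEa).sub (hside b hab.le (by linarith) hEb)).add hmid
  have hfin : 0 ≤ E a - E b + ∫ t in a..b, D t := by
    refine ge_of_tendsto hlim ?_
    filter_upwards [Ioo_mem_nhdsGT hτ] with ε hε
    refine (h ε hε).trans (le_of_eq ?_)
    have hz : ∀ t, t ∉ I → ∀ c ∈ Icc a b, deriv Real.smoothTransition ((t - c) / ε) = 0 :=
      fun t ht c hc => by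
        rcases le_or_gt t c with h1 | h1
        · exact deriv_smoothTransition_of_nonpos
            (div_nonpos_of_nonpos_of_nonneg (by linarith) hε.1.le)
        · refine deriv_smoothTransition_of_one_le ((one_le_div hε.1).2 ?_)
          by_contra h2
          exact ht ⟨by linarith [hc.1], by linarith [hc.2, hε.2]⟩
    have hw : ∀ t, t ∉ I → smoothWindow ε a b t = 0 := fun t ht =>
      smoothWindow_eq_zero_of_notMem_Ioo hε.1 hab.le
        fun h' => ht ⟨h'.1.le, by linarith [h'.2, hε.2]⟩
    have hpt : ∀ t, deriv (smoothWindow ε a b) t * E t + smoothWindow ε a b t * D t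
        = (ε⁻¹ * deriv Real.smoothTransition ((t - a) / ε) * I.indicator E t
          - ε⁻¹ * deriv Real.smoothTransition ((t - b) / ε) * I.indicator E t)
          + I.indicator D t * smoothWindow ε a b t := fun t => by
      rw [(hasDerivAt_smoothWindow ε a b t).deriv]
      by_cases ht : t ∈ I
      · rw [indicator_of_mem ht, indicator_of_mem ht]; ring
      · rw [hz t ht a ⟨le_rfl, hab.le⟩, hz t ht b ⟨hab.le, le_rfl⟩, hw t ht]; ring
    have i₁ := integrable_kernel_mul hε.1 hmE (hbd hEM) a
    have i₂ := integrable_kernel_mul hε.1 hmE (hbd hEM) b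
    have i₃ := integral_add (i₁.sub i₂) (integrable_mul_smoothWindow hmD (hbd hDM) hε.1 a b)
    simp only [Pi.sub_apply] at i₃
    rw [setIntegral_eq_integral_of_forall_compl_eq_zero, smoothAvg_eq_integral hε.1,
      smoothAvg_eq_integral hε.1, ← integral_sub i₁ i₂, ← i₃]
    · exact integral_congr_ae (Eventually.of_forall hpt)
    · intro t ht
      have ht0 : t ≤ 0 := not_lt.1 ht
      rw [hpt, smoothWindow_eq_zero_of_notMem_Ioo hε.1 hab.le fun h' => by linarith [h'.1],
        deriv_smoothTransition_of_nonpos,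
        deriv_smoothTransition_of_nonpos]
      · ring
      all_goals exact div_nonpos_of_nonpos_of_nonneg (by linarith) hε.1.le
  linarith

lemma abs_smoothCurveFlux_le {e g : ℝ → ℝ → ℝ} {M : ℝ} (heM : ∀ x t, |e x t| ≤ M)
    (hgM : ∀ x t, |g x t| ≤ M) (ε : ℝ) (y d : ℝ → ℝ) (t : ℝ) :
    |smoothCurveFlux e g ε y d t| ≤ M + |d t| * M := by
  refine (abs_sub _ _).trans (add_le_add (abs_smoothAvg_le (hgM · t) _ _) ?_)
  rw [abs_mul]
  exact mul_le_mul_of_nonneg_left (abs_smoothAvg_le (heM · t) _ _) (abs_nonneg _)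

lemma measurable_smoothCurveFlux {e g : ℝ → ℝ → ℝ}
    (he : Measurable fun p : ℝ × ℝ => e p.1 p.2) (hg : Measurable fun p : ℝ × ℝ => g p.1 p.2)
    (ε : ℝ) {y d : ℝ → ℝ} (hy : Measurable y) (hd : Measurable d) :
    Measurable (smoothCurveFlux e g ε y d) :=
  (measurable_smoothAvg hg hy ε).sub (hd.mul (measurable_smoothAvg he hy ε))

/-- The weak entropy inequality `∂ₜ e + ∂ₓ g ≤ 0` on `ℝ × (0, ∞)`. -/
def WeakEntropyIneq (e g : ℝ → ℝ → ℝ) : Prop :=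
  ∀ θ : ℝ → ℝ → ℝ, ContDiff ℝ (⊤ : ℕ∞) (fun p : ℝ × ℝ => θ p.1 p.2) →
    HasCompactSupport (fun p : ℝ × ℝ => θ p.1 p.2) →
    (∀ x t, 0 ≤ θ x t) → (∀ x t, t ≤ 0 → θ x t = 0) →
    0 ≤ ∫ t in Ioi (0 : ℝ), ∫ x : ℝ,
      (e x t * deriv (fun s => θ x s) t + g x t * deriv (fun y => θ y t) x)

lemma contDiff_smoothWindow (ε : ℝ) {E : Type*} [NormedAddCommGroup E] [NormedSpace ℝ E]
    {x y z : E → ℝ} (hx : ContDiff ℝ (⊤ : ℕ∞) x) (hy : ContDiff ℝ (⊤ : ℕ∞) y)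
    (hz : ContDiff ℝ (⊤ : ℕ∞) z) :
    ContDiff ℝ (⊤ : ℕ∞) fun p => smoothWindow ε (y p) (z p) (x p) :=
  (Real.smoothTransition.contDiff.comp ((hx.sub hy).div_const ε)).sub
    (Real.smoothTransition.contDiff.comp ((hx.sub hz).div_const ε))

lemma exists_forall_mem_Icc_neg_sub {y z : ℝ → ℝ} (hy : Continuous y) (hz : Continuous z)
    (ε a b : ℝ) : ∃ R, ∀ t ∈ Icc a b, y t ∈ Icc (-R) (R - ε) ∧ z t ∈ Icc (-R) (R - ε) := by
  obtain ⟨B, hB⟩ := isCompact_Icc.exists_bound_of_continuousOn (s := Icc a b) hy.continuousOn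
  obtain ⟨B', hB'⟩ := isCompact_Icc.exists_bound_of_continuousOn (s := Icc a b) hz.continuousOn
  refine ⟨|B| + |B'| + |ε|, fun t ht => ?_⟩
  have h1 := abs_le.1 ((hB t ht).trans (le_abs_self B))
  have h2 := abs_le.1 ((hB' t ht).trans (le_abs_self B'))
  refine ⟨⟨?_, ?_⟩, ⟨?_, ?_⟩⟩ <;>
  linarith [le_abs_self ε, abs_nonneg B, abs_nonneg B', abs_nonneg ε, h1.1, h1.2, h2.1, h2.2]

lemma integral_smoothWindow_sub_le_of_contDiff {e g : ℝ → ℝ → ℝ} {M : ℝ}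
    (he : Measurable fun p : ℝ × ℝ => e p.1 p.2) (hg : Measurable fun p : ℝ × ℝ => g p.1 p.2)
    (heM : ∀ x t, |e x t| ≤ M) (hgM : ∀ x t, |g x t| ≤ M) (hec : L1locCont e)
    (hent : WeakEntropyIneq e g) {y z : ℝ → ℝ} (hy : ContDiff ℝ (⊤ : ℕ∞) y)
    (hz : ContDiff ℝ (⊤ : ℕ∞) z) {a b ε : ℝ} (hε : 0 < ε) (ha : 0 ≤ a) (hab : a < b)
    (hyz : ∀ t ∈ Icc a b, y t < z t) :
    (∫ x, e x b * smoothWindow ε (y b) (z b) x) - (∫ x, e x a * smoothWindow ε (y a) (z a) x)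
      ≤ ∫ t in a..b, (smoothCurveFlux e g ε y (deriv y) t
        - smoothCurveFlux e g ε z (deriv z) t) := by
  have hM : 0 ≤ M := (abs_nonneg _).trans (heM 0 0)
  obtain ⟨τ, hτ, hyzτ⟩ : ∃ τ > 0, ∀ t ∈ Icc a (b + τ), y t ≤ z t := by
    have h1 : ∀ᶠ t in 𝓝 b, y t < z t :=
      (hy.continuous.tendsto b).eventually_lt (hz.continuous.tendsto b) (hyz b ⟨hab.le, le_rfl⟩)
    obtain ⟨τ, hτ, h2⟩ := Metric.eventually_nhds_iff.1 h1
    refine ⟨τ / 2, half_pos hτ, fun t ht => ?_⟩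
    rcases le_or_gt t b with h | h
    · exact (hyz t ⟨ht.1, h⟩).le
    · refine (h2 ?_).le
      rw [Real.dist_eq, abs_of_pos (sub_pos.2 h)]
      linarith [ht.2]
  obtain ⟨R, hR⟩ := exists_forall_mem_Icc_neg_sub hy.continuous hz.continuous ε a (b + τ)
  have hdy : Continuous (deriv y) := (hy.of_le (by simp) : ContDiff ℝ 1 y).continuous_deriv le_rfl
  have hdz : Continuous (deriv z) := (hz.of_le (by simp) : ContDiff ℝ 1 z).continuous_deriv le_rfl
  obtain ⟨B, hB⟩ := isCompact_Icc.exists_bound_of_continuousOn (s := Icc a (b + τ))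
    hdy.continuousOn
  obtain ⟨B', hB'⟩ := isCompact_Icc.exists_bound_of_continuousOn (s := Icc a (b + τ))
    hdz.continuousOn
  have hmem : a ∈ Icc a (b + τ) := ⟨le_rfl, by linarith⟩
  have hB0 : 0 ≤ B := (norm_nonneg _).trans (hB a hmem)
  have hB0' : 0 ≤ B' := (norm_nonneg _).trans (hB' a hmem)
  have hR0 : 0 ≤ R := by linarith [(hR a hmem).1.1, (hR a hmem).1.2]
  refine sub_le_integral_of_smoothWindow (τ := τ)
    (M := 2 * R * M + ((M + B * M) + (M + B' * M)))
    (E := fun t => ∫ x, e x t * smoothWindow ε (y t) (z t) x) ha hab hτ ?_ ?_ (fun t ht => ?_)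
    (fun t ht => ?_) ?_ ?_ fun h hh => ?_
  · have h1 : Measurable fun p : ℝ × ℝ =>
        e p.2 p.1 * smoothWindow ε (y p.1) (z p.1) p.2 := by
      refine (he.comp (measurable_snd.prodMk measurable_fst)).mul ?_
      exact (contDiff_smoothWindow ε contDiff_snd (hy.comp contDiff_fst)
        (hz.comp contDiff_fst)).continuous.measurable
    exact h1.stronglyMeasurable.integral_prod_right.measurable
  · exact (measurable_smoothCurveFlux he hg ε hy.continuous.measurable hdy.measurable).sub
      (measurable_smoothCurveFlux he hg ε hz.continuous.measurable hdz.measurable)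
  · have h1 := norm_integral_le_of_norm_le
      (f := fun x => e x t * smoothWindow ε (y t) (z t) x) (integrable_indicator_Icc_const R M)
      (Eventually.of_forall fun x =>
        abs_mul_smoothWindow_le hε (hR t ht).1 (hR t ht).2 (heM x t) x)
    rw [integral_indicator measurableSet_Icc, setIntegral_const, Real.volume_real_Icc_of_le
      (by linarith), smul_eq_mul] at h1
    refine h1.trans ?_
    have : 0 ≤ (M + B * M) + (M + B' * M) := by positivity
    linarith
  · refine (abs_sub _ _).trans ?_
    have h1 := abs_smoothCurveFlux_le heM hgM ε y (deriv y) t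
    have h2 := abs_smoothCurveFlux_le heM hgM ε z (deriv z) t
    have h3 : |deriv y t| * M ≤ B * M := mul_le_mul_of_nonneg_right (hB t ht) hM
    have h4 : |deriv z t| * M ≤ B' * M := mul_le_mul_of_nonneg_right (hB' t ht) hM
    have : 0 ≤ 2 * R * M := by positivity
    linarith
  · exact tendsto_integral_smoothWindow_nhdsGE he heM hec ha hε hy.continuous hz.continuous
  · exact tendsto_integral_smoothWindow_nhdsGE he heM hec (ha.trans hab.le) hε hy.continuous
      hz.continuous
  · have hχ0 : ∀ t, t ∉ Icc a (b + τ) → smoothWindow h a b t = 0 := fun t ht =>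
      smoothWindow_eq_zero_of_notMem_Ioo hh.1 hab.le
        fun h' => ht ⟨h'.1.le, by linarith [h'.2, hh.2]⟩
    have key := hent (fun x t => smoothWindow h a b t * smoothWindow ε (y t) (z t) x)
      ((contDiff_smoothWindow h contDiff_snd contDiff_const contDiff_const).mul
        (contDiff_smoothWindow ε contDiff_fst (hy.comp contDiff_snd) (hz.comp contDiff_snd)))
      (HasCompactSupport.intro ((isCompact_Icc (a := -R) (b := R)).prod
        (isCompact_Icc (a := a) (b := b + τ))) fun p hp => ?_) (fun x t => ?_) fun x t ht => ?_
    · refine key.trans (le_of_eq ?_)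
      congr 1; ext t
      exact integral_entropy_smoothWindow he hg heM hgM hε (hy.differentiable (by simp))
        (hz.differentiable (by simp)) (fun t => (hasDerivAt_smoothWindow h a b t).differentiableAt) t
    · by_cases ht : p.2 ∈ Icc a (b + τ)
      · rw [smoothWindow_eq_zero hε (hR _ ht).1 (hR _ ht).2 fun hx => hp ⟨hx, ht⟩, mul_zero]
      · rw [hχ0 _ ht, zero_mul]
    · by_cases ht : t ∈ Icc a (b + τ)
      · exact mul_nonneg (smoothWindow_nonneg hh.1 hab.le t)
          (smoothWindow_nonneg hε (hyzτ t ht) x)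
      · rw [hχ0 t ht, zero_mul]
    · rw [smoothWindow_eq_zero_of_notMem_Ioo hh.1 hab.le fun h' => by linarith [h'.1], zero_mul]

lemma exists_contDiff_approx_primitive {d : ℝ → ℝ} (hd : Integrable d) {a b : ℝ} (hab : a < b)
    (c : ℝ) {ε : ℝ} (hε : 0 < ε) : ∃ y : ℝ → ℝ, ContDiff ℝ (⊤ : ℕ∞) y ∧
      (∫ t in a..b, |deriv y t - d t|) ≤ ε ∧
      ∀ t ∈ Icc a b, |y t - (c + ∫ s in a..t, d s)| ≤ ε := by
  obtain ⟨g, -, hdg, hgc, hgi⟩ := hd.exists_hasCompactSupport_integral_sub_le (half_pos hε)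
  obtain ⟨p, hp⟩ := exists_polynomial_near_of_continuousOn a b g hgc.continuousOn
    (ε / 2 / (b - a)) (div_pos (half_pos hε) (sub_pos.2 hab))
  have hpc : Continuous fun t => p.eval t := p.continuous
  have hder : ∀ t, HasDerivAt (fun t => c + ∫ s in a..t, p.eval s) (p.eval t) t := fun t =>
    (hpc.integral_hasStrictDerivAt a t).hasDerivAt.const_add c
  have hderiv : deriv (fun t => c + ∫ s in a..t, p.eval s) = fun t => p.eval t :=
    funext fun t => (hder t).deriv
  have hint : ∀ u v, IntervalIntegrable (fun t => |p.eval t - d t|) volume u v := fun u v =>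
    ((hpc.intervalIntegrable u v).sub hd.intervalIntegrable).abs
  have hmain : (∫ t in a..b, |p.eval t - d t|) ≤ ε := by
    have h1 : (∫ t in a..b, |p.eval t - g t|) ≤ ε / 2 := by
      have h2 := intervalIntegral.integral_mono_on hab.le
        (((hpc.sub hgc).abs).intervalIntegrable a b)
        (intervalIntegrable_const (c := ε / 2 / (b - a)) (μ := volume)) fun t ht => (hp t ht).le
      rwa [intervalIntegral.integral_const, smul_eq_mul,
        mul_div_cancel₀ _ (sub_pos.2 hab).ne'] at h2
    have h3 : (∫ t in a..b, |g t - d t|) ≤ ε / 2 := by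
      rw [intervalIntegral.integral_of_le hab.le]
      refine (setIntegral_le_integral (hgi.sub hd).abs
        (Eventually.of_forall fun t => abs_nonneg _)).trans (le_trans (le_of_eq ?_) hdg)
      congr 1; ext t
      exact abs_sub_comm _ _
    have i₁ : IntervalIntegrable (fun t => |p.eval t - g t|) volume a b :=
      ((hpc.sub hgc).abs).intervalIntegrable a b
    have i₂ : IntervalIntegrable (fun t => |g t - d t|) volume a b :=
      (hgi.sub hd).abs.intervalIntegrable
    have h4 := intervalIntegral.integral_mono_on hab.le (hint a b) (i₁.add i₂)
      fun t _ => abs_sub_le (p.eval t) (g t) (d t)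
    rw [intervalIntegral.integral_add i₁ i₂] at h4
    linarith
  refine ⟨fun t => c + ∫ s in a..t, p.eval s, ?_, ?_, fun t ht => ?_⟩
  · refine contDiff_infty_iff_deriv.2 ⟨fun t => (hder t).differentiableAt, ?_⟩
    rw [hderiv]
    simpa [Polynomial.coe_aeval_eq_eval] using p.contDiff_aeval (𝕜 := ℝ) (⊤ : ℕ∞)
  · rwa [hderiv]
  · rw [add_sub_add_left_eq_sub, ← intervalIntegral.integral_sub (hpc.intervalIntegrable _ _)
      hd.intervalIntegrable]
    refine (intervalIntegral.abs_integral_le_integral_abs ht.1).trans (le_trans ?_ hmain)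
    exact intervalIntegral.integral_mono_interval le_rfl ht.1 ht.2
      (Eventually.of_forall fun t => abs_nonneg _) (hint a b)

lemma intervalIntegrable_smoothCurveFlux {e g : ℝ → ℝ → ℝ} {M : ℝ}
    (he : Measurable fun p : ℝ × ℝ => e p.1 p.2) (hg : Measurable fun p : ℝ × ℝ => g p.1 p.2)
    (heM : ∀ x t, |e x t| ≤ M) (hgM : ∀ x t, |g x t| ≤ M) (ε : ℝ) {y d : ℝ → ℝ}
    (hy : Measurable y) {a b : ℝ} (hd : IntervalIntegrable d volume a b) :
    IntervalIntegrable (smoothCurveFlux e g ε y d) volume a b := by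
  rw [intervalIntegrable_iff] at hd ⊢
  have hc : IntegrableOn (fun _ => M) (uIoc a b) := integrableOn_const (by simp)
  have hb : Integrable (fun t => M + |d t| * M) (volume.restrict (uIoc a b)) :=
    Integrable.add hc (Integrable.mul_const (Integrable.norm hd) M)
  refine hb.mono' ?_ (Eventually.of_forall fun t => abs_smoothCurveFlux_le heM hgM ε y d t)
  exact (measurable_smoothAvg hg hy ε).aestronglyMeasurable.sub
    (hd.aestronglyMeasurable.mul (measurable_smoothAvg he hy ε).aestronglyMeasurable)

lemma tendsto_integral_smoothCurveFlux {e g : ℝ → ℝ → ℝ} {M : ℝ}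
    (he : Measurable fun p : ℝ × ℝ => e p.1 p.2) (hg : Measurable fun p : ℝ × ℝ => g p.1 p.2)
    (heM : ∀ x t, |e x t| ≤ M) (hgM : ∀ x t, |g x t| ≤ M) {ε : ℝ} (hε : 0 < ε) {x d : ℝ → ℝ}
    {a b : ℝ} (hab : a ≤ b) (hd : IntervalIntegrable d volume a b) {y d' : ℕ → ℝ → ℝ}
    (hy : ∀ n, Measurable (y n)) (hd' : ∀ n, IntervalIntegrable (d' n) volume a b)
    (hyx : ∀ t ∈ Icc a b, Tendsto (fun n => y n t) atTop (𝓝 (x t)))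
    (hder : Tendsto (fun n => ∫ t in a..b, |d' n t - d t|) atTop (𝓝 0)) :
    Tendsto (fun n => ∫ t in a..b, smoothCurveFlux e g ε (y n) (d' n) t) atTop
      (𝓝 (∫ t in a..b, smoothCurveFlux e g ε x d t)) := by
  have hm : ∀ {f : ℝ → ℝ → ℝ}, (Measurable fun p : ℝ × ℝ => f p.1 p.2) →
      ∀ t, Measurable fun x => f x t :=
    fun hf t => hf.comp (measurable_id.prodMk measurable_const)
  have h1 : Tendsto (fun n => ∫ t in a..b, smoothCurveFlux e g ε (y n) d t) atTop
      (𝓝 (∫ t in a..b, smoothCurveFlux e g ε x d t)) := by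
    refine intervalIntegral.tendsto_integral_filter_of_dominated_convergence
      (fun t => M + |d t| * M)
      (Eventually.of_forall fun n => (intervalIntegrable_smoothCurveFlux he hg heM hgM ε (hy n)
        hd).def'.aestronglyMeasurable)
      (Eventually.of_forall fun n => Eventually.of_forall fun t _ =>
        abs_smoothCurveFlux_le heM hgM ε (y n) d t)
      (intervalIntegrable_const.add (hd.abs.mul_const M))
      (Eventually.of_forall fun t ht => ?_)
    rw [uIoc_of_le hab] at ht
    have hyt := hyx t ⟨ht.1.le, ht.2⟩
    exact (((continuous_smoothAvg hε (hm hg t) (hgM · t)).tendsto _).comp hyt).sub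
      ((((continuous_smoothAvg hε (hm he t) (heM · t)).tendsto _).comp hyt).const_mul _)
  have i : ∀ n, IntervalIntegrable (fun t => (d' n t - d t) * smoothAvg ε (fun x => e x t) (y n t))
      volume a b := fun n => by
    have := (hd' n).sub hd
    rw [intervalIntegrable_iff] at this ⊢
    exact this.mul_bdd (measurable_smoothAvg he (hy n) ε).aestronglyMeasurable
      (Eventually.of_forall fun t => abs_smoothAvg_le (heM · t) _ _)
  have h2 : Tendsto (fun n => ∫ t in a..b,
      (d' n t - d t) * smoothAvg ε (fun x => e x t) (y n t)) atTop (𝓝 0) := by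
    have h3 := hder.mul_const M
    rw [zero_mul] at h3
    refine squeeze_zero_norm (fun n => ?_) h3
    refine (intervalIntegral.norm_integral_le_integral_norm hab).trans ?_
    rw [← intervalIntegral.integral_mul_const]
    refine intervalIntegral.integral_mono_on hab (i n).norm
      (((hd' n).sub hd).abs.mul_const M) fun t _ => ?_
    rw [norm_mul]
    exact mul_le_mul_of_nonneg_left (abs_smoothAvg_le (heM · t) _ _) (norm_nonneg _)
  have h3 := h1.sub h2
  rw [sub_zero] at h3
  refine h3.congr fun n => ?_
  rw [← intervalIntegral.integral_sub
    (intervalIntegrable_smoothCurveFlux he hg heM hgM ε (hy n) hd) (i n)]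
  congr 1; ext t
  rw [smoothCurveFlux, smoothCurveFlux]
  ring

lemma integral_smoothWindow_sub_le {e g : ℝ → ℝ → ℝ} {M : ℝ}
    (he : Measurable fun p : ℝ × ℝ => e p.1 p.2) (hg : Measurable fun p : ℝ × ℝ => g p.1 p.2)
    (heM : ∀ x t, |e x t| ≤ M) (hgM : ∀ x t, |g x t| ≤ M) (hec : L1locCont e)
    (hent : WeakEntropyIneq e g) {y z d d' : ℝ → ℝ} (hd : Integrable d) (hd' : Integrable d')
    {a b δ ε : ℝ} (hε : 0 < ε) (ha : 0 ≤ a) (hab : a < b)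
    (hy : ∀ t ∈ Icc a b, y t = y a + ∫ s in a..t, d s)
    (hz : ∀ t ∈ Icc a b, z t = z a + ∫ s in a..t, d' s)
    (hδ : 0 < δ) (hyz : ∀ t ∈ Icc a b, y t + δ ≤ z t) :
    (∫ x, e x b * smoothWindow ε (y b) (z b) x) - (∫ x, e x a * smoothWindow ε (y a) (z a) x)
      ≤ (∫ t in a..b, smoothCurveFlux e g ε y d t) - ∫ t in a..b, smoothCurveFlux e g ε z d' t := by
  have hpos : ∀ n : ℕ, (0 : ℝ) < 1 / ((n : ℝ) + 1) := fun n => Nat.one_div_pos_of_nat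
  choose Y hYc hYd hYe using fun n => exists_contDiff_approx_primitive hd hab (y a) (hpos n)
  choose Z hZc hZd hZe using fun n => exists_contDiff_approx_primitive hd' hab (z a) (hpos n)
  have hptw : ∀ {x c : ℝ → ℝ} {X : ℕ → ℝ → ℝ}, (∀ t ∈ Icc a b, x t = x a + ∫ s in a..t, c s) →
      (∀ n, ∀ t ∈ Icc a b, |X n t - (x a + ∫ s in a..t, c s)| ≤ 1 / ((n : ℝ) + 1)) →
      ∀ t ∈ Icc a b, Tendsto (fun n => X n t) atTop (𝓝 (x t)) := fun {x c X} hx hX t ht => by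
    rw [tendsto_iff_norm_sub_tendsto_zero]
    refine squeeze_zero_norm (fun n => ?_) tendsto_one_div_add_atTop_nhds_zero_nat
    rw [norm_norm, hx t ht]
    exact hX n t ht
  have hY := hptw hy hYe
  have hZ := hptw hz hZe
  have hmem_a : a ∈ Icc a b := ⟨le_rfl, hab.le⟩
  have hmem_b : b ∈ Icc a b := ⟨hab.le, le_rfl⟩
  have hm : ∀ t, Measurable fun x => e x t := fun t => he.comp (measurable_id.prodMk measurable_const)
  have hside : ∀ t ∈ Icc a b, Tendsto (fun n => ∫ x, e x t * smoothWindow ε (Y n t) (Z n t) x)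
      atTop (𝓝 (∫ x, e x t * smoothWindow ε (y t) (z t) x)) := fun t ht =>
    tendsto_integral_mul_smoothWindow_of_tendsto (hm t) (heM · t) hε (hY t ht) (hZ t ht)
  have hdi : ∀ {X : ℝ → ℝ}, ContDiff ℝ (⊤ : ℕ∞) X → IntervalIntegrable (deriv X) volume a b :=
    fun {X} hX => ((hX.of_le (by simp) : ContDiff ℝ 1 X).continuous_deriv
      le_rfl).intervalIntegrable a b
  have hL1 : ∀ {c : ℝ → ℝ} {X : ℕ → ℝ → ℝ},
      (∀ n : ℕ, (∫ t in a..b, |deriv (X n) t - c t|) ≤ 1 / ((n : ℝ) + 1)) →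
      Tendsto (fun n => ∫ t in a..b, |deriv (X n) t - c t|) atTop (𝓝 0) := fun h =>
    squeeze_zero (fun n => intervalIntegral.integral_nonneg hab.le fun t _ => abs_nonneg _) h
      tendsto_one_div_add_atTop_nhds_zero_nat
  have hfY := tendsto_integral_smoothCurveFlux he hg heM hgM hε hab.le hd.intervalIntegrable
    (fun n => (hYc n).continuous.measurable) (fun n => hdi (hYc n)) hY (hL1 hYd)
  have hfZ := tendsto_integral_smoothCurveFlux he hg heM hgM hε hab.le hd'.intervalIntegrable
    (fun n => (hZc n).continuous.measurable) (fun n => hdi (hZc n)) hZ (hL1 hZd)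
  refine le_of_tendsto_of_tendsto ((hside b hmem_b).sub (hside a hmem_a)) (hfY.sub hfZ) ?_
  filter_upwards [tendsto_one_div_add_atTop_nhds_zero_nat.eventually_lt_const (half_pos hδ)]
    with n hn
  rw [← intervalIntegral.integral_sub
    (intervalIntegrable_smoothCurveFlux he hg heM hgM ε (hYc n).continuous.measurable (hdi (hYc n)))
    (intervalIntegrable_smoothCurveFlux he hg heM hgM ε (hZc n).continuous.measurable (hdi (hZc n)))]
  refine integral_smoothWindow_sub_le_of_contDiff he hg heM hgM hec hent (hYc n) (hZc n) hε ha hab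
    fun t ht => ?_
  have h1 := hYe n t ht
  have h2 := hZe n t ht
  rw [← hy t ht] at h1
  rw [← hz t ht] at h2
  linarith [(abs_le.1 h1).2, (abs_le.1 h2).1, hyz t ht]

lemma entropy_sub_le_of_primitive {e g : ℝ → ℝ → ℝ} {M : ℝ}
    (he : Measurable fun p : ℝ × ℝ => e p.1 p.2) (hg : Measurable fun p : ℝ × ℝ => g p.1 p.2)
    (heM : ∀ x t, |e x t| ≤ M) (hgM : ∀ x t, |g x t| ≤ M) (hec : L1locCont e)
    (hent : WeakEntropyIneq e g) {y z d d' : ℝ → ℝ} (hd : Integrable d) (hd' : Integrable d')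
    {a b δ : ℝ} (ha : 0 ≤ a) (hab : a < b)
    (hy : ∀ t, y t = y a + ∫ s in a..t, d s) (hz : ∀ t, z t = z a + ∫ s in a..t, d' s)
    (hδ : 0 < δ) (hyz : ∀ t ∈ Icc a b, y t + δ ≤ z t) {ep gp em gm : ℝ → ℝ}
    (hep : ∀ t ∈ Ioc a b, Tendsto (fun x => e x t) (𝓝[>] y t) (𝓝 (ep t)))
    (hgp : ∀ t ∈ Ioc a b, Tendsto (fun x => g x t) (𝓝[>] y t) (𝓝 (gp t)))
    (hem : ∀ t ∈ Ioc a b, Tendsto (fun x => e x t) (𝓝[<] z t) (𝓝 (em t)))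
    (hgm : ∀ t ∈ Ioc a b, Tendsto (fun x => g x t) (𝓝[<] z t) (𝓝 (gm t))) :
    (∫ x in y b..z b, e x b) - (∫ x in y a..z a, e x a) ≤
      (∫ t in a..b, (gp t - d t * ep t)) - ∫ t in a..b, (gm t - d' t * em t) := by
  have hm : ∀ {f : ℝ → ℝ → ℝ}, (Measurable fun p : ℝ × ℝ => f p.1 p.2) →
      ∀ t, Measurable fun x => f x t :=
    fun hf t => hf.comp (measurable_id.prodMk measurable_const)
  have hmeas : ∀ {x c : ℝ → ℝ}, Integrable c → (∀ t, x t = x a + ∫ s in a..t, c s) →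
      Measurable x := fun {x c} hc hx => by
    have h : Continuous fun t => x a + ∫ s in a..t, c s :=
      continuous_const.add (intervalIntegral.continuous_primitive (fun _ _ => hc.intervalIntegrable) a)
    rw [funext hx]
    exact h.measurable
  have hym := hmeas hd hy
  have hzm := hmeas hd' hz
  have hsmall : ∀ᶠ ε in 𝓝[>] (0 : ℝ), 0 < ε ∧ ε < δ / 2 :=
    Ioo_mem_nhdsGT (half_pos hδ)
  have hside : ∀ t ∈ Icc a b, Tendsto (fun ε => ∫ x, e x t * smoothWindow ε (y t) (z t - ε) x)
      (𝓝[>] 0) (𝓝 (∫ x in y t..z t, e x t)) := fun t ht => by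
    have hlt : y t < z t := by linarith [hyz t ht]
    have h : ∫ x in y t..z t, e x t = ∫ x, e x t * (Ioo (y t) (z t)).indicator (fun _ => 1) x := by
      rw [intervalIntegral.integral_of_le hlt.le, integral_Ioc_eq_integral_Ioo,
        ← integral_indicator measurableSet_Ioo]
      congr 1; ext x
      by_cases hx : x ∈ Ioo (y t) (z t) <;> simp [hx]
    rw [h]
    refine tendsto_integral_mul_smoothWindow (R := |y t| + |z t| + δ) (hm he t) (heM · t)
      (hsmall.mono fun ε h => h.1) (hsmall.mono fun ε h => ?_) (hsmall.mono fun ε h => ?_)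
      (Eventually.of_forall fun x => tendsto_smoothWindow_sub hlt x)
    · constructor <;> linarith [neg_abs_le (y t), le_abs_self (y t), abs_nonneg (z t), h.1, h.2]
    · constructor <;> linarith [neg_abs_le (z t), le_abs_self (z t), abs_nonneg (y t), h.1, h.2]
  have hflux : ∀ {x c ex gx : ℝ → ℝ} {s : ℝ}, Measurable x → Integrable c →
      (∀ t ∈ Ioc a b, Tendsto (fun ε => smoothAvg ε (fun x => e x t) (x t - s * ε)) (𝓝[>] 0)
        (𝓝 (ex t))) →
      (∀ t ∈ Ioc a b, Tendsto (fun ε => smoothAvg ε (fun x => g x t) (x t - s * ε)) (𝓝[>] 0)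
        (𝓝 (gx t))) →
      Tendsto (fun ε => ∫ t in a..b, smoothCurveFlux e g ε (fun t => x t - s * ε) c t) (𝓝[>] 0)
        (𝓝 (∫ t in a..b, (gx t - c t * ex t))) := fun {x c ex gx s} hx hc hex hgx => by
    refine intervalIntegral.tendsto_integral_filter_of_dominated_convergence
      (fun t => M + |c t| * M)
      (Eventually.of_forall fun ε => (intervalIntegrable_smoothCurveFlux he hg heM hgM ε
        (hx.sub_const _) hc.intervalIntegrable).def'.aestronglyMeasurable)
      (Eventually.of_forall fun ε => Eventually.of_forall fun t _ =>
        abs_smoothCurveFlux_le heM hgM ε _ c t)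
      (intervalIntegrable_const.add (hc.intervalIntegrable.abs.mul_const M))
      (Eventually.of_forall fun t ht => ?_)
    rw [uIoc_of_le hab.le] at ht
    exact (hgx t ht).sub ((hex t ht).const_mul _)
  have hL := hflux (s := 0) hym hd
    (fun t ht => by simpa using tendsto_smoothAvg_nhdsGT (hm he t) (heM · t) (hep t ht))
    (fun t ht => by simpa using tendsto_smoothAvg_nhdsGT (hm hg t) (hgM · t) (hgp t ht))
  have hR := hflux (s := 1) hzm hd'
    (fun t ht => by simpa using tendsto_smoothAvg_sub_nhdsLT (hm he t) (heM · t) (hem t ht))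
    (fun t ht => by simpa using tendsto_smoothAvg_sub_nhdsLT (hm hg t) (hgM · t) (hgm t ht))
  refine le_of_tendsto_of_tendsto ((hside b ⟨hab.le, le_rfl⟩).sub (hside a ⟨le_rfl, hab.le⟩))
    (hL.sub hR) ?_
  filter_upwards [hsmall] with ε hε
  simp only [zero_mul, sub_zero, one_mul]
  refine integral_smoothWindow_sub_le (z := fun t => z t - ε) he hg heM hgM hec hent hd hd' hε.1 ha
    hab (fun t _ => hy t) (fun t _ => ?_) (half_pos hδ) fun t ht => ?_
  · rw [hz t]; ring
  · linarith [hyz t ht, hε.2]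

lemma L1locCont.comp {U : ℝ → ℝ → ℝ} (hU : L1locCont U)
    (hm : Measurable fun p : ℝ × ℝ => U p.1 p.2) {M : ℝ} (hM : ∀ x t, |U x t| ≤ M) {K : NNReal}
    {φ : ℝ → ℝ} (hφc : Continuous φ) (hφ : LipschitzOnWith K φ (Icc (-M) M)) :
    L1locCont fun x t => φ (U x t) := by
  intro R hR t₀ ht₀
  have hmt : ∀ t, Measurable fun x => U x t := fun t =>
    hm.comp (measurable_id.prodMk measurable_const)
  have hint : ∀ t, IntervalIntegrable (fun x => |U x t - U x t₀|) volume (-R) R := fun t => by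
    refine (intervalIntegrable_const (c := M + M)).mono_fun'
      (((hmt t).sub (hmt t₀)).abs).aestronglyMeasurable (Eventually.of_forall fun x => ?_)
    refine (abs_abs _).trans_le ?_
    exact (abs_sub _ _).trans (add_le_add (hM x t) (hM x t₀))
  have hbd : ∀ t x, |φ (U x t) - φ (U x t₀)| ≤ K * |U x t - U x t₀| := fun t x =>
    hφ.dist_le_mul _ (abs_le.1 (hM x t)) _ (abs_le.1 (hM x t₀))
  have h := (hU R hR t₀ ht₀).const_mul (K : ℝ)
  rw [mul_zero] at h
  refine squeeze_zero (fun t => intervalIntegral.integral_nonneg (by linarith) fun x _ =>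
    abs_nonneg _) (fun t => ?_) h
  rw [← intervalIntegral.integral_const_mul]
  refine intervalIntegral.integral_mono_on (by linarith) ?_ ((hint t).const_mul _)
    fun x _ => hbd t x
  refine ((hint t).const_mul (K : ℝ)).mono_fun' ((hφc.measurable.comp (hmt t)).sub
    (hφc.measurable.comp (hmt t₀))).abs.aestronglyMeasurable (Eventually.of_forall fun x => ?_)
  exact (abs_abs _).trans_le (hbd t x)

lemma contDiff_relEnt {η : ℝ → ℝ} (hη : ContDiff ℝ (⊤ : ℕ∞) η) (C : ℝ) :
    ContDiff ℝ (⊤ : ℕ∞) fun v => relEnt η v C :=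
  (hη.sub contDiff_const).sub (contDiff_const.mul (contDiff_id.sub contDiff_const))

lemma deriv_relEnt {η : ℝ → ℝ} (hη : Differentiable ℝ η) (C : ℝ) :
    deriv (fun v => relEnt η v C) = fun v => deriv η v - deriv η C := by
  funext v
  have h := ((hη v).hasDerivAt.sub_const (η C)).sub
    (((hasDerivAt_id v).sub_const C).const_mul (deriv η C))
  exact h.deriv.trans (by simp)

lemma hasDerivAt_relFlux {A η : ℝ → ℝ} (hA : Continuous (deriv A)) (hη : Continuous (deriv η))
    (C v : ℝ) :
    HasDerivAt (fun v => relFlux A η v C) ((deriv η v - deriv η C) * deriv A v) v :=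
  (((hη.sub continuous_const).mul hA).integral_hasStrictDerivAt C v).hasDerivAt

lemma contDiff_relFlux {A η : ℝ → ℝ} (hA : ContDiff ℝ (⊤ : ℕ∞) A) (hη : ContDiff ℝ (⊤ : ℕ∞) η)
    (C : ℝ) : ContDiff ℝ (⊤ : ℕ∞) fun v => relFlux A η v C := by
  have hA' := (contDiff_infty_iff_deriv.1 hA).2
  have hη' := (contDiff_infty_iff_deriv.1 hη).2
  have h := hasDerivAt_relFlux hA'.continuous hη'.continuous C
  refine contDiff_infty_iff_deriv.2 ⟨fun v => (h v).differentiableAt, ?_⟩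
  rw [funext fun v => (h v).deriv]
  exact (hη'.sub contDiff_const).mul hA'

lemma IsEntropySol.weakEntropyIneq {A η : ℝ → ℝ} {U : ℝ → ℝ → ℝ} (hU : IsEntropySol A U)
    (hA : ContDiff ℝ (⊤ : ℕ∞) A) (hη : ContDiff ℝ (⊤ : ℕ∞) η) (hconv : ∀ v, 0 ≤ deriv (deriv η) v)
    (C : ℝ) : WeakEntropyIneq (fun x t => relEnt η (U x t) C) fun x t => relFlux A η (U x t) C := by
  have hA' := (contDiff_infty_iff_deriv.1 hA).2.continuous
  have hη' := contDiff_infty_iff_deriv.1 hη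
  refine hU.entropy _ _ (contDiff_relEnt hη C) (contDiff_relFlux hA hη C) (fun v => ?_) fun v => ?_
  · rw [deriv_relEnt hη'.1, deriv_sub_const]
    exact hconv v
  · rw [deriv_relEnt hη'.1, (hasDerivAt_relFlux hA' hη'.2.continuous C v).deriv]

lemma LipschitzOnWith.exists_integrable_primitive {K : NNReal} {x dx : ℝ → ℝ} {t₀ T : ℝ}
    (hx : LipschitzOnWith K x (Icc t₀ T))
    (hdx : ∀ᵐ t ∂(volume.restrict (Icc t₀ T)), HasDerivAt x (dx t) t) {a b : ℝ} (ha : t₀ ≤ a)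
    (hab : a ≤ b) (hb : b ≤ T) :
    Integrable ((Ioc a b).indicator dx) ∧
      ∀ t ∈ Icc a b, x t = x a + ∫ s in a..t, (Ioc a b).indicator dx s := by
  have hac : ∀ t ∈ Icc a b, AbsolutelyContinuousOnInterval x a t := fun t ht =>
    LipschitzOnWith.absolutelyContinuousOnInterval (K := K)
      (hx.mono (by rw [uIcc_of_le ht.1]; exact Icc_subset_Icc ha (ht.2.trans hb)))
  have hsub : Ioc a b ⊆ Icc t₀ T := Ioc_subset_Icc_self.trans (Icc_subset_Icc ha hb)
  have hae : ∀ᵐ t ∂(volume.restrict (Ioc a b)), deriv x t = dx t :=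
    (ae_restrict_of_ae_restrict_of_subset hsub hdx).mono fun t ht => ht.deriv
  refine ⟨?_, fun t ht => ?_⟩
  · rw [integrable_indicator_iff measurableSet_Ioc]
    have h := (hac b ⟨hab, le_rfl⟩).intervalIntegrable_deriv
    rw [intervalIntegrable_iff_integrableOn_Ioc_of_le hab] at h
    exact h.congr hae
  · have h := (hac t ht).integral_deriv_eq_sub
    have h2 : ∫ s in a..t, (Ioc a b).indicator dx s = ∫ s in a..t, deriv x s := by
      rw [intervalIntegral.integral_of_le ht.1, intervalIntegral.integral_of_le ht.1]
      refine integral_congr_ae ?_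
      have hsub' : Ioc a t ⊆ Ioc a b := Ioc_subset_Ioc_right ht.2
      filter_upwards [ae_restrict_of_ae_restrict_of_subset hsub' hae,
        ae_restrict_mem measurableSet_Ioc] with s hs hs'
      rw [indicator_of_mem (hsub' hs'), hs]
    rw [h2, h]
    ring

/-- **Lemma 2.2 (inner relative entropy estimate).** For Lipschitz curves `x_L, x_R` staying
at distance at least `δ > 0` apart, the relative entropy of `U` with respect to a constant `C`
between the curves changes in time at most by the boundary relative entropy flux terms. -/
theorem inner_entropy_estimate
    (A : ℝ → ℝ) (hA : ContDiff ℝ (⊤ : ℕ∞) A) (hA'' : ∀ x, 0 < deriv (deriv A) x)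
    (U Um Up : ℝ → ℝ → ℝ)
    (hsol : IsEntropySol A U) (hlim : HasSideLimits U Um Up) (hcont : L1locCont U)
    (η : ℝ → ℝ) (hη : ContDiff ℝ (⊤ : ℕ∞) η) (hconv : ∀ v, 0 ≤ deriv (deriv η) v)
    (C t₀ T δ : ℝ) (ht₀ : 0 ≤ t₀) (hT : t₀ < T) (hδ : 0 < δ)
    (xL xR dxL dxR : ℝ → ℝ) (KL KR : NNReal)
    (hxL : LipschitzOnWith KL xL (Icc t₀ T)) (hxR : LipschitzOnWith KR xR (Icc t₀ T))
    (hdxL : ∀ᵐ t ∂(volume.restrict (Icc t₀ T)), HasDerivAt xL (dxL t) t)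
    (hdxR : ∀ᵐ t ∂(volume.restrict (Icc t₀ T)), HasDerivAt xR (dxR t) t)
    (hsep : ∀ t ∈ Icc t₀ T, δ ≤ xR t - xL t)
    (a b : ℝ) (ha : t₀ ≤ a) (hab : a < b) (hb : b ≤ T) :
    (∫ x in xL b..xR b, relEnt η (U x b) C) - (∫ x in xL a..xR a, relEnt η (U x a) C) ≤
      (∫ t in a..b, (relFlux A η (Up (xL t) t) C - dxL t * relEnt η (Up (xL t) t) C))
        - ∫ t in a..b, (relFlux A η (Um (xR t) t) C - dxR t * relEnt η (Um (xR t) t) C) := by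
  obtain ⟨M, hM⟩ := hsol.bounded
  have hE := contDiff_relEnt hη C
  have hF := contDiff_relFlux hA hη C
  have hbound : ∀ {φ : ℝ → ℝ}, Continuous φ → ∃ B, ∀ x t, |φ (U x t)| ≤ B := fun {φ} hφ => by
    obtain ⟨B, hB⟩ := isCompact_Icc.exists_bound_of_continuousOn (s := Icc (-M) M) hφ.continuousOn
    exact ⟨B, fun x t => hB _ (abs_le.1 (hM x t))⟩
  obtain ⟨B₁, hB₁⟩ := hbound hE.continuous
  obtain ⟨B₂, hB₂⟩ := hbound hF.continuous
  obtain ⟨K, hK⟩ := ((hE.of_le (by simp) : ContDiff ℝ 1 _).locallyLipschitz.locallyLipschitzOn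
    (s := Icc (-M) M)).exists_lipschitzOnWith_of_compact isCompact_Icc
  obtain ⟨hdL, hpL⟩ := hxL.exists_integrable_primitive hdxL ha hab.le hb
  obtain ⟨hdR, hpR⟩ := hxR.exists_integrable_primitive hdxR ha hab.le hb
  have hmem_a : a ∈ Icc a b := ⟨le_rfl, hab.le⟩
  have hmem_b : b ∈ Icc a b := ⟨hab.le, le_rfl⟩
  have hpos : ∀ t ∈ Ioc a b, 0 < t := fun t ht => (ht₀.trans ha).trans_lt ht.1
  have hmem : ∀ t ∈ Ioc a b, t ∈ Icc a b := fun t ht => ⟨ht.1.le, ht.2⟩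
  have key := entropy_sub_le_of_primitive
    (y := fun t => xL a + ∫ s in a..t, (Ioc a b).indicator dxL s)
    (z := fun t => xR a + ∫ s in a..t, (Ioc a b).indicator dxR s)
    (ep := fun t => relEnt η (Up (xL t) t) C) (gp := fun t => relFlux A η (Up (xL t) t) C)
    (em := fun t => relEnt η (Um (xR t) t) C) (gm := fun t => relFlux A η (Um (xR t) t) C)
    (hE.continuous.measurable.comp hsol.measurable)
    (hF.continuous.measurable.comp hsol.measurable)
    (fun x t => (hB₁ x t).trans (le_max_left B₁ B₂))
    (fun x t => (hB₂ x t).trans (le_max_right B₁ B₂))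
    (hcont.comp hsol.measurable hM hE.continuous hK) (hsol.weakEntropyIneq hA hη hconv C) hdL hdR
    (ht₀.trans ha) hab (fun t => by simp) (fun t => by simp) hδ
    (fun t ht => by
      rw [← hpL t ht, ← hpR t ht]
      linarith [hsep t ⟨ha.trans ht.1, ht.2.trans hb⟩])
    (fun t ht => by
      rw [← hpL t (hmem t ht)]
      exact (hE.continuous.tendsto _).comp (hlim.right _ t (hpos t ht)))
    (fun t ht => by
      rw [← hpL t (hmem t ht)]
      exact (hF.continuous.tendsto _).comp (hlim.right _ t (hpos t ht)))
    (fun t ht => by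
      rw [← hpR t (hmem t ht)]
      exact (hE.continuous.tendsto _).comp (hlim.left _ t (hpos t ht)))
    (fun t ht => by
      rw [← hpR t (hmem t ht)]
      exact (hF.continuous.tendsto _).comp (hlim.left _ t (hpos t ht)))
  have hcongr : ∀ d p q : ℝ → ℝ, ∫ t in a..b, (p t - (Ioc a b).indicator d t * q t) =
      ∫ t in a..b, (p t - d t * q t) := fun d p q => by
    refine intervalIntegral.integral_congr_ae (Eventually.of_forall fun t ht => ?_)
    rw [uIoc_of_le hab.le] at ht
    rw [indicator_of_mem ht]
  rwa [hcongr, hcongr, ← hpL b hmem_b, ← hpR b hmem_b, ← hpL a hmem_a, ← hpR a hmem_a] at key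
end
end

section
/- Let g : [0,1] → ℝ and h : [0,1] → ℝ be continuously differentiable functions such that g′(s) ≥ ε_g > 0 and h′(s) ≥ ε_h > 0 for all s ∈ (0,1), and suppose ∫₀¹ g(s) ds = 1. Then ∫₀¹ g(s) h(s) ds − ∫₀¹ h(s) ds ≥ ε_g ε_h / 12. -/
open MeasureTheory Set Filter Topology

noncomputable section

/-- If `f' ≥ c` and `k' ≥ d` with `c, d ≥ 0`, the product of increments of `f` and `k` is at
least `c * d` times the squared increment of the variable. -/
theorem mul_sq_le_mul_sub_of_le_deriv {f k : ℝ → ℝ} {c d : ℝ} {D : Set ℝ} (hD : Convex ℝ D)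
    (hc : 0 ≤ c) (hd : 0 ≤ d)
    (hf : ContinuousOn f D) (hf' : DifferentiableOn ℝ f (interior D))
    (hk : ContinuousOn k D) (hk' : DifferentiableOn ℝ k (interior D))
    (hcf : ∀ s ∈ interior D, c ≤ deriv f s) (hdk : ∀ s ∈ interior D, d ≤ deriv k s)
    {x y : ℝ} (hx : x ∈ D) (hy : y ∈ D) :
    c * d * (x - y) ^ 2 ≤ (f x - f y) * (k x - k y) := by
  wlog hxy : y ≤ x generalizing x y
  · have := this hy hx (le_of_not_ge hxy)
    linarith
  have h1 := hD.mul_sub_le_image_sub_of_le_deriv hf hf' hcf y hy x hx hxy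
  have h2 := hD.mul_sub_le_image_sub_of_le_deriv hk hk' hdk y hy x hx hxy
  have hxy' : 0 ≤ x - y := sub_nonneg.2 hxy
  calc c * d * (x - y) ^ 2 = (c * (x - y)) * (d * (x - y)) := by ring
    _ ≤ _ := mul_le_mul h1 h2 (by positivity) ((by positivity : 0 ≤ c * (x - y)).trans h1)

/-- **Lemma 2.5.** If `g, h : [0,1] → ℝ` are `C¹` with `g' ≥ ε_g > 0`, `h' ≥ ε_h > 0` on
`(0,1)` and `∫₀¹ g = 1`, then `∫₀¹ g h - ∫₀¹ h ≥ ε_g ε_h / 12`. -/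
theorem mean_one_correlation
    (g h : ℝ → ℝ) (εg εh : ℝ) (hεg : 0 < εg) (hεh : 0 < εh)
    (hgC : ContDiffOn ℝ 1 g (Icc 0 1)) (hhC : ContDiffOn ℝ 1 h (Icc 0 1))
    (hg' : ∀ s ∈ Ioo (0 : ℝ) 1, εg ≤ deriv g s)
    (hh' : ∀ s ∈ Ioo (0 : ℝ) 1, εh ≤ deriv h s)
    (hmean : (∫ s in (0 : ℝ)..1, g s) = 1) :
    εg * εh / 12 ≤ (∫ s in (0 : ℝ)..1, g s * h s) - ∫ s in (0 : ℝ)..1, h s := by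
  have hgc := hgC.continuousOn
  have hhc := hhC.continuousOn
  have hgd := (hgC.differentiableOn one_ne_zero).mono interior_subset
  have hhd := (hhC.differentiableOn one_ne_zero).mono interior_subset
  have key : ∀ x ∈ Icc (0 : ℝ) 1, ∀ y ∈ Icc (0 : ℝ) 1,
      εg * εh * (x - y) ^ 2 ≤ (g x - g y) * (h x - h y) := fun x hx y hy =>
    mul_sq_le_mul_sub_of_le_deriv (convex_Icc 0 1) hεg.le hεh.le hgc hgd hhc hhd
      (by rwa [interior_Icc]) (by rwa [interior_Icc]) hx hy
  have hgi : IntervalIntegrable g volume 0 1 := hgc.intervalIntegrable_of_Icc zero_le_one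
  have hhi : IntervalIntegrable h volume 0 1 := hhc.intervalIntegrable_of_Icc zero_le_one
  have hghi : IntervalIntegrable (fun s => g s * h s) volume 0 1 :=
    (hgc.mul hhc).intervalIntegrable_of_Icc zero_le_one
  set P := ∫ s in (0 : ℝ)..1, g s * h s
  set H := ∫ s in (0 : ℝ)..1, h s
  have inner : ∀ y ∈ Icc (0 : ℝ) 1,
      εg * εh * (1 / 3 - y + y ^ 2) ≤ P - h y - g y * H + g y * h y := by
    intro y hy
    have hmono := intervalIntegral.integral_mono_on (μ := volume) (zero_le_one' ℝ)
      (Continuous.intervalIntegrable (μ := volume) (by fun_prop) 0 1)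
      (((hgc.sub continuousOn_const).mul (hhc.sub continuousOn_const)).intervalIntegrable_of_Icc
        zero_le_one) fun x hx => key x hx y hy
    have hl : ∫ x in (0 : ℝ)..1, εg * εh * (x - y) ^ 2 = εg * εh * (1 / 3 - y + y ^ 2) := by
      rw [intervalIntegral.integral_const_mul,
        intervalIntegral.integral_comp_sub_right (fun x => x ^ 2), integral_pow]
      push_cast
      ring
    have hr : ∫ x in (0 : ℝ)..1, (g x - g y) * (h x - h y)
        = P - h y - g y * H + g y * h y := by
      have : (fun x => (g x - g y) * (h x - h y))
          = fun x => g x * h x - h y * g x - g y * h x + g y * h y := by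
        funext x
        ring
      rw [this, intervalIntegral.integral_add
          ((hghi.sub (hgi.const_mul _)).sub (hhi.const_mul _)) intervalIntegrable_const,
        intervalIntegral.integral_sub (hghi.sub (hgi.const_mul _)) (hhi.const_mul _),
        intervalIntegral.integral_sub hghi (hgi.const_mul _),
        intervalIntegral.integral_const_mul, intervalIntegral.integral_const_mul, hmean,
        intervalIntegral.integral_const]
      simp [P, H]
    exact hl ▸ hr ▸ hmono
  have hPi : IntervalIntegrable (fun _ => P) volume (0 : ℝ) 1 := intervalIntegrable_const
  have houter := intervalIntegral.integral_mono_on (μ := volume) (zero_le_one' ℝ)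
    (Continuous.intervalIntegrable (μ := volume) (by fun_prop) 0 1)
    (((hPi.sub hhi).sub (hgi.mul_const H)).add hghi) inner
  have hl : ∫ y in (0 : ℝ)..1, εg * εh * (1 / 3 - y + y ^ 2) = εg * εh / 6 := by
    rw [intervalIntegral.integral_const_mul, intervalIntegral.integral_add
        (Continuous.intervalIntegrable (μ := volume) (by fun_prop) 0 1)
        (Continuous.intervalIntegrable (μ := volume) (by fun_prop) 0 1),
      intervalIntegral.integral_sub intervalIntegrable_const
        (Continuous.intervalIntegrable (μ := volume) (by fun_prop) 0 1),
      integral_pow, integral_id, intervalIntegral.integral_const]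
    norm_num
    ring
  rw [hl, intervalIntegral.integral_add ((hPi.sub hhi).sub (hgi.mul_const H)) hghi,
    intervalIntegral.integral_sub (hPi.sub hhi) (hgi.mul_const H),
    intervalIntegral.integral_sub hPi hhi,
    intervalIntegral.integral_mul_const, hmean, intervalIntegral.integral_const] at houter
  simp only [sub_zero, one_smul, one_mul] at houter
  change _ ≤ P - H - H + P at houter
  linarith
end
end

section
/- Let A : ℝ → ℝ and η : ℝ → ℝ be smooth with A″ > 0 and η″ > 0 everywhere. Let R > 0 and let ε_A, ε_η, L_η > 0 satisfy ε_A ≤ A″(ξ) and ε_η ≤ η″(ξ) ≤ L_η for all |ξ| ≤ R. Then for all U, C ∈ [−R,R] with U ≠ C, the partial derivative of f with respect to its second variable satisfies ∂f/∂C(U,C) ≥ ε_A ε_η² / (3 L_η²) > 0. -/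
open MeasureTheory Set Filter Topology

noncomputable section

/-- The mean value theorem for two points of `[-R, R]` in either order. -/
theorem exists_slope_between {h h' : ℝ → ℝ} (hd : ∀ x, HasDerivAt h (h' x) x) {R C v : ℝ}
    (hC : |C| ≤ R) (hv : |v| ≤ R) (hne : v ≠ C) :
    ∃ ξ, |ξ| ≤ R ∧ 0 < (ξ - C) * (v - C) ∧ h v - h C = h' ξ * (v - C) := by
  have hcont : Continuous h := continuous_iff_continuousAt.2 fun x => (hd x).continuousAt
  rw [abs_le] at hC hv
  rcases lt_or_gt_of_ne hne with hlt | hlt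
  · obtain ⟨ξ, ⟨h1, h2⟩, h3⟩ :=
      exists_hasDerivAt_eq_slope h h' hlt hcont.continuousOn fun x _ => hd x
    refine ⟨ξ, abs_le.2 ⟨by linarith, by linarith⟩, by nlinarith, ?_⟩
    rw [eq_div_iff (by linarith)] at h3
    linarith
  · obtain ⟨ξ, ⟨h1, h2⟩, h3⟩ :=
      exists_hasDerivAt_eq_slope h h' hlt hcont.continuousOn fun x _ => hd x
    refine ⟨ξ, abs_le.2 ⟨by linarith, by linarith⟩, by nlinarith, ?_⟩
    rw [eq_div_iff (by linarith)] at h3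
    linarith

/-- A function with nonnegative derivative on `[-R, R]` has increments of the sign of `v - C`. -/
theorem mul_sub_nonneg_of_deriv_nonneg {h h' : ℝ → ℝ} (hd : ∀ x, HasDerivAt h (h' x) x) {R C : ℝ}
    (hC : |C| ≤ R) (hpos : ∀ x, |x| ≤ R → 0 ≤ h' x) {v : ℝ} (hv : |v| ≤ R) :
    0 ≤ (v - C) * (h v - h C) := by
  rcases eq_or_ne v C with rfl | hne
  · simp
  obtain ⟨ξ, hξ, -, h3⟩ := exists_slope_between hd hC hv hne
  rw [h3]
  nlinarith [mul_nonneg (hpos ξ hξ) (sq_nonneg (v - C))]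

/-- A function on `[-R, R]` whose derivative at `x` has the sign of `x - C` is minimal at `C`. -/
theorem le_of_mul_deriv_nonneg {h h' : ℝ → ℝ} (hd : ∀ x, HasDerivAt h (h' x) x) {R C : ℝ}
    (hC : |C| ≤ R) (hpos : ∀ x, |x| ≤ R → 0 ≤ (x - C) * h' x) {v : ℝ} (hv : |v| ≤ R) :
    h C ≤ h v := by
  rcases eq_or_ne v C with rfl | hne
  · exact le_rfl
  obtain ⟨ξ, hξ, h2, h3⟩ := exists_slope_between hd hC hv hne
  have h4 := hpos ξ hξ
  have h5 : 0 ≤ h' ξ * (v - C) := by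
    by_contra! hlt
    linarith [mul_neg_of_neg_of_pos hlt h2, mul_nonneg h4 (sq_nonneg (v - C))]
  linarith

/-- Quadratic lower bound for the relative entropy. -/
theorem le_relEnt {g g' g'' : ℝ → ℝ} (hg : ∀ x, HasDerivAt g (g' x) x)
    (hg' : ∀ x, HasDerivAt g' (g'' x) x) {R C ε : ℝ} (hC : |C| ≤ R)
    (hε : ∀ x, |x| ≤ R → ε ≤ g'' x) {v : ℝ} (hv : |v| ≤ R) :
    ε / 2 * (v - C) ^ 2 ≤ g v - g C - g' C * (v - C) := by
  have hd : ∀ x, HasDerivAt (fun x => g x - g' C * (x - C) - ε / 2 * (x - C) ^ 2)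
      (g' x - g' C - ε * (x - C)) x := fun x => by
    have hx := (hasDerivAt_id' x).sub_const C
    exact (((hg x).sub (hx.const_mul (g' C))).sub ((hx.pow 2).const_mul (ε / 2))).congr_deriv
      (by simp; ring)
  have hd' : ∀ x, HasDerivAt (fun x => g' x - ε * x) (g'' x - ε) x := fun x => by
    exact ((hg' x).sub ((hasDerivAt_id' x).const_mul ε)).congr_deriv (by simp)
  have key := le_of_mul_deriv_nonneg hd hC (fun x hx => by
    have := mul_sub_nonneg_of_deriv_nonneg hd' hC (fun y hy => sub_nonneg.2 (hε y hy)) hx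
    linarith) hv
  simp only [sub_self, mul_zero] at key
  linarith

/-- Quadratic lower bound for the relative entropy with the roles of the points exchanged. -/
theorem le_relEnt_swap {g g' g'' : ℝ → ℝ} (hg : ∀ x, HasDerivAt g (g' x) x)
    (hg' : ∀ x, HasDerivAt g' (g'' x) x) {R C ε : ℝ} (hC : |C| ≤ R)
    (hε : ∀ x, |x| ≤ R → ε ≤ g'' x) {v : ℝ} (hv : |v| ≤ R) :
    ε / 2 * (v - C) ^ 2 ≤ (v - C) * g' v - (g v - g C) := by
  linarith [le_relEnt hg hg' hv hε hC, (by ring : ε / 2 * (v - C) ^ 2 = ε / 2 * (C - v) ^ 2)]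

/-- A quantitative Chebyshev integral inequality for `g'` and `a'`, where `H` is a primitive of
`g' a'`: both factors increase at the rates `εg` and `εa`. -/
theorem chebyshev_lower_bound {a a' a'' g g' g'' H : ℝ → ℝ}
    (ha : ∀ x, HasDerivAt a (a' x) x) (ha' : ∀ x, HasDerivAt a' (a'' x) x)
    (hg : ∀ x, HasDerivAt g (g' x) x) (hg' : ∀ x, HasDerivAt g' (g'' x) x)
    (hH : ∀ x, HasDerivAt H (g' x * a' x) x)
    {R C εa εg : ℝ} (hC : |C| ≤ R) (hεa0 : 0 < εa) (hεg0 : 0 < εg)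
    (hεa : ∀ x, |x| ≤ R → εa ≤ a'' x) (hεg : ∀ x, |x| ≤ R → εg ≤ g'' x)
    {v : ℝ} (hv : |v| ≤ R) :
    εa * εg / 12 * (v - C) ^ 4 ≤ (v - C) * (H v - H C - g' C * (a v - a C)) -
      (a v - a C) * (g v - g C - g' C * (v - C)) := by
  have hd : ∀ x, HasDerivAt (fun x => (x - C) * (H x - H C) - (a x - a C) * (g x - g C) -
        εa * εg / 12 * (x - C) ^ 4)
      ((H x - H C) + (x - C) * (g' x * a' x) - a' x * (g x - g C) - (a x - a C) * g' x -
        εa * εg / 3 * (x - C) ^ 3) x := fun x => by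
    have hx := (hasDerivAt_id' x).sub_const C
    exact (((hx.mul ((hH x).sub_const (H C))).sub
      (((ha x).sub_const (a C)).mul ((hg x).sub_const (g C)))).sub
      ((hx.pow 4).const_mul (εa * εg / 12))).congr_deriv (by simp; ring)
  have hd' : ∀ x, HasDerivAt (fun x => (H x - H C) + (x - C) * (g' x * a' x) -
        a' x * (g x - g C) - (a x - a C) * g' x - εa * εg / 3 * (x - C) ^ 3)
      (g'' x * ((x - C) * a' x - (a x - a C)) + a'' x * ((x - C) * g' x - (g x - g C)) -
        εa * εg * (x - C) ^ 2) x := fun x => by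
    have hx := (hasDerivAt_id' x).sub_const C
    exact ((((((hH x).sub_const (H C)).add (hx.mul ((hg' x).mul (ha' x)))).sub
      ((ha' x).mul ((hg x).sub_const (g C)))).sub
      (((ha x).sub_const (a C)).mul (hg' x))).sub
      ((hx.pow 3).const_mul (εa * εg / 3))).congr_deriv (by simp; ring)
  have key := le_of_mul_deriv_nonneg hd hC (fun x hx => by
    have := mul_sub_nonneg_of_deriv_nonneg hd' hC (fun y hy => by
      have h1 := mul_le_mul (hεg y hy) (le_relEnt_swap ha ha' hC hεa hy) (by positivity)
        (hεg0.le.trans (hεg y hy))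
      have h2 := mul_le_mul (hεa y hy) (le_relEnt_swap hg hg' hC hεg hy) (by positivity)
        (hεa0.le.trans (hεa y hy))
      linarith) hx
    simpa using this) hv
  simp only [sub_self, mul_zero, ne_eq, OfNat.ofNat_ne_zero, not_false_eq_true,
    zero_pow] at key
  linarith

/-- The derivative of a smooth function is differentiable. -/
theorem hasDerivAt_deriv {g : ℝ → ℝ} (hg : ContDiff ℝ (⊤ : ℕ∞) g) (x : ℝ) :
    HasDerivAt (deriv g) (deriv (deriv g) x) x :=
  ((contDiff_infty_iff_deriv.1 hg).2.differentiable (by simp) x).hasDerivAt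

/-- The relative entropy flux in terms of a primitive of `η' A'`. -/
theorem relFlux_eq {A η H : ℝ → ℝ} (hA : ContDiff ℝ (⊤ : ℕ∞) A) (hη : ContDiff ℝ (⊤ : ℕ∞) η)
    (hH : ∀ x, HasDerivAt H (deriv η x * deriv A x) x) (v C : ℝ) :
    relFlux A η v C = H v - H C - deriv η C * (A v - A C) := by
  have hcA : Continuous (deriv A) := hA.continuous_deriv (by simp)
  have hcη : Continuous (deriv η) := hη.continuous_deriv (by simp)
  have hdA : ∀ x, HasDerivAt A (deriv A x) x := fun x =>
    (hA.differentiable (by simp) x).hasDerivAt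
  unfold relFlux
  rw [intervalIntegral.integral_eq_sub_of_hasDerivAt
    (f := fun x => H x - deriv η C * A x)
    (fun x _ => ((hH x).sub ((hdA x).const_mul (deriv η C))).congr_deriv (by ring))
    (Continuous.intervalIntegrable (by fun_prop) _ _)]
  ring

/-- Differentiating `normFlux` in its second variable away from the diagonal. -/
theorem hasDerivAt_normFlux_snd {A η H : ℝ → ℝ} (hA : ContDiff ℝ (⊤ : ℕ∞) A)
    (hη : ContDiff ℝ (⊤ : ℕ∞) η) (hH : ∀ x, HasDerivAt H (deriv η x * deriv A x) x)
    {U C : ℝ} (hUC : U ≠ C) (hE : relEnt η U C ≠ 0) :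
    HasDerivAt (fun c => normFlux A η U c)
      (deriv (deriv η) C * ((U - C) * relFlux A η U C - (A U - A C) * relEnt η U C) /
        relEnt η U C ^ 2) C := by
  have hdA := (hA.differentiable (by simp) C).hasDerivAt
  have hdη := (hη.differentiable (by simp) C).hasDerivAt
  have hdη' := hasDerivAt_deriv hη C
  have hF : HasDerivAt (fun c => relFlux A η U c) (-(deriv (deriv η) C * (A U - A C))) C := by
    simp only [relFlux_eq hA hη hH]
    exact (((hH C).const_sub (H U)).sub (hdη'.mul (hdA.const_sub (A U)))).congr_deriv
      (by ring)
  have hEd : HasDerivAt (fun c => relEnt η U c) (-(deriv (deriv η) C * (U - C))) C := by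
    unfold relEnt
    exact ((hdη.const_sub (η U)).sub (hdη'.mul ((hasDerivAt_id' C).const_sub U))).congr_deriv
      (by ring)
  have hq := hF.div hEd hE
  refine (hq.congr_of_eventuallyEq ?_).congr_deriv (by ring)
  filter_upwards [isOpen_ne.mem_nhds hUC.symm] with c hc
  simp [normFlux, Ne.symm hc]

/-- **Lemma 2.6 (ii).** On a bounded set, the partial derivative of the normalized relative
entropy flux `f` with respect to its second variable exists and satisfies
`∂f/∂C ≥ ε_A ε_η² / (3 L_η²) > 0`. -/
theorem normFlux_deriv_snd_lower_bound
    (A η : ℝ → ℝ) (hA : ContDiff ℝ (⊤ : ℕ∞) A) (hη : ContDiff ℝ (⊤ : ℕ∞) η)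
    (hA'' : ∀ x, 0 < deriv (deriv A) x) (hη'' : ∀ x, 0 < deriv (deriv η) x)
    (R εA εη Lη : ℝ) (hR : 0 < R) (hεA : 0 < εA) (hεη : 0 < εη) (hLη : 0 < Lη)
    (hAbd : ∀ ξ : ℝ, |ξ| ≤ R → εA ≤ deriv (deriv A) ξ)
    (hηbd : ∀ ξ : ℝ, |ξ| ≤ R → εη ≤ deriv (deriv η) ξ ∧ deriv (deriv η) ξ ≤ Lη)
    (U C : ℝ) (hU : |U| ≤ R) (hC : |C| ≤ R) (hUC : U ≠ C) :
    ∃ d, HasDerivAt (fun c => normFlux A η U c) d C ∧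
      εA * εη ^ 2 / (3 * Lη ^ 2) ≤ d ∧ 0 < εA * εη ^ 2 / (3 * Lη ^ 2) := by
  have hpos : 0 < εA * εη ^ 2 / (3 * Lη ^ 2) := by positivity
  have hcA : Continuous (deriv A) := hA.continuous_deriv (by simp)
  have hcη : Continuous (deriv η) := hη.continuous_deriv (by simp)
  have hdA : ∀ x, HasDerivAt A (deriv A x) x := fun x =>
    (hA.differentiable (by simp) x).hasDerivAt
  have hdη : ∀ x, HasDerivAt η (deriv η x) x := fun x =>
    (hη.differentiable (by simp) x).hasDerivAt
  have hdA' : ∀ x, HasDerivAt (deriv A) (deriv (deriv A) x) x := hasDerivAt_deriv hA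
  have hdη' : ∀ x, HasDerivAt (deriv η) (deriv (deriv η) x) x := hasDerivAt_deriv hη
  obtain ⟨H, hH⟩ : ∃ H : ℝ → ℝ, ∀ x, HasDerivAt H (deriv η x * deriv A x) x :=
    ⟨fun x => ∫ w in (0 : ℝ)..x, deriv η w * deriv A w,
      fun x => (hcη.mul hcA).integral_hasStrictDerivAt 0 x |>.hasDerivAt⟩
  have hD : 0 < (U - C) ^ 2 := by have := sub_ne_zero.2 hUC; positivity
  have hE1 : εη / 2 * (U - C) ^ 2 ≤ relEnt η U C :=
    le_relEnt hdη hdη' hC (fun x hx => (hηbd x hx).1) hU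
  have hE2 : relEnt η U C ≤ Lη / 2 * (U - C) ^ 2 := by
    have := le_relEnt (fun x => (hdη x).neg) (fun x => (hdη' x).neg) (ε := -Lη) hC
      (fun x hx => neg_le_neg (hηbd x hx).2) hU
    simp only [Pi.neg_apply] at this
    unfold relEnt
    linarith
  have hE : 0 < relEnt η U C := lt_of_lt_of_le (by positivity) hE1
  have hB : εA * εη / 12 * (U - C) ^ 4 ≤
      (U - C) * relFlux A η U C - (A U - A C) * relEnt η U C := by
    rw [relFlux_eq hA hη hH]
    exact chebyshev_lower_bound hdA hdA' hdη hdη' hH hC hεA hεη hAbd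
      (fun x hx => (hηbd x hx).1) hU
  refine ⟨_, hasDerivAt_normFlux_snd hA hη hH hUC hE.ne', ?_, hpos⟩
  rw [le_div_iff₀ (by positivity)]
  calc εA * εη ^ 2 / (3 * Lη ^ 2) * relEnt η U C ^ 2
      ≤ εA * εη ^ 2 / (3 * Lη ^ 2) * (Lη / 2 * (U - C) ^ 2) ^ 2 := by gcongr
    _ = εη * (εA * εη / 12 * (U - C) ^ 4) := by field_simp; ring
    _ ≤ _ := mul_le_mul (hηbd C hC).1 hB (by positivity) (hη'' C).le
end
end

section
/- Let A : ℝ → ℝ be smooth with A″ > 0 everywhere, and take the quadratic entropy η(v) = v²/2, so that η(v|C) = (v−C)²/2 and F(v,C) = ∫_C^v (w − C) A′(w) dw. Then: (a) for all U, C ∈ ℝ with U ≠ C, f(U,C) = 2∫₀¹ s A′(C + s(U−C)) ds; and (b) if ε_A ≤ A″(ξ) ≤ L_A for all |ξ| ≤ R, then for all U, C ∈ [−R,R] with U ≠ C one has (2/3) ε_A ≤ ∂f/∂U(U,C) ≤ (2/3) L_A and (1/3) ε_A ≤ ∂f/∂C(U,C) ≤ (1/3) L_A. -/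
open MeasureTheory Set Filter Topology

noncomputable section

theorem deriv_sq_div_two (v : ℝ) : deriv (fun v : ℝ => v ^ 2 / 2) v = v := by
  have h := ((hasDerivAt_id v).pow 2).div_const 2
  simp only [id] at h
  rw [show (fun v : ℝ => v ^ 2 / 2) = fun x => (id ^ 2 : ℝ → ℝ) x / 2 from rfl, h.deriv]
  norm_num

theorem relEnt_sq_div_two (v C : ℝ) : relEnt (fun v => v ^ 2 / 2) v C = (v - C) ^ 2 / 2 := by
  simp only [relEnt, deriv_sq_div_two]
  ring

theorem relFlux_sq_div_two (A : ℝ → ℝ) (v C : ℝ) :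
    relFlux A (fun v => v ^ 2 / 2) v C = ∫ w in C..v, (w - C) * deriv A w := by
  simp only [relFlux, deriv_sq_div_two]

/-- Integration by parts for the relative entropy flux, in terms of an antiderivative of `A`. -/
theorem relFlux_sq_div_two_eq {A B : ℝ → ℝ} (hA : ContDiff ℝ (⊤ : ℕ∞) A)
    (hB : ∀ x, HasDerivAt B (A x) x) (v C : ℝ) :
    relFlux A (fun v => v ^ 2 / 2) v C = (v - C) * A v - (B v - B C) := by
  have hA' : Continuous (deriv A) := hA.continuous_deriv (by simp)
  rw [relFlux_sq_div_two, intervalIntegral.integral_eq_sub_of_hasDerivAt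
    (f := fun w => (w - C) * A w - B w)]
  · ring
  · intro w _
    have hAw : HasDerivAt A (deriv A w) w := (hA.differentiable (by simp) w).hasDerivAt
    refine HasDerivAt.congr_deriv ((((hasDerivAt_id w).sub_const C).mul hAw).sub (hB w)) ?_
    simp
  · exact Continuous.intervalIntegrable (by fun_prop) _ _

theorem normFlux_sq_div_two_eq {A B : ℝ → ℝ} (hA : ContDiff ℝ (⊤ : ℕ∞) A)
    (hB : ∀ x, HasDerivAt B (A x) x) {v C : ℝ} (h : v ≠ C) :
    normFlux A (fun v => v ^ 2 / 2) v C
      = ((v - C) * A v - (B v - B C)) / ((v - C) ^ 2 / 2) := by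
  rw [normFlux, if_neg h, relFlux_sq_div_two_eq hA hB, relEnt_sq_div_two]

/-- The difference quotient of a function with nonnegative derivative between `a` and `b`
is nonnegative, whatever the order of `a` and `b`. -/
theorem div_sub_nonneg_of_hasDerivAt {G g : ℝ → ℝ} {a b : ℝ} (hab : b ≠ a)
    (hG : ∀ x, HasDerivAt G (g x) x) (hg : ∀ x ∈ uIcc a b, 0 ≤ g x) :
    0 ≤ (G b - G a) / (b - a) := by
  have hc : Continuous G := continuous_iff_continuousAt.2 fun x => (hG x).continuousAt
  rcases lt_or_gt_of_ne hab with h | h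
  · obtain ⟨c, hcm, hce⟩ := exists_hasDerivAt_eq_slope G g h hc.continuousOn fun x _ => hG x
    rw [← neg_sub (G a), ← neg_sub a, neg_div_neg_eq, ← hce]
    exact hg c (by rw [uIcc_comm]; exact Icc_subset_uIcc (Ioo_subset_Icc_self hcm))
  · obtain ⟨c, hcm, hce⟩ := exists_hasDerivAt_eq_slope G g h hc.continuousOn fun x _ => hG x
    rw [← hce]
    exact hg c (Icc_subset_uIcc (Ioo_subset_Icc_self hcm))

/-- Comparison of difference quotients: if `G' = p h`, `P' = p` with `p ≥ 0` and `m ≤ h ≤ M`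
between `a` and `b`, then the increments of `G` are controlled by those of `P`. -/
theorem div_sub_mem_of_hasDerivAt_mul {G P p h : ℝ → ℝ} {a b m M : ℝ} (hab : b ≠ a)
    (hG : ∀ x, HasDerivAt G (p x * h x) x) (hP : ∀ x, HasDerivAt P (p x) x)
    (hp : ∀ x ∈ uIcc a b, 0 ≤ p x) (hh : ∀ x ∈ uIcc a b, m ≤ h x ∧ h x ≤ M) :
    m * ((P b - P a) / (b - a)) ≤ (G b - G a) / (b - a) ∧
      (G b - G a) / (b - a) ≤ M * ((P b - P a) / (b - a)) := by
  constructor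
  · have := div_sub_nonneg_of_hasDerivAt hab (fun x => (hG x).sub ((hP x).const_mul m))
      fun x hx => by nlinarith [mul_nonneg (hp x hx) (sub_nonneg.2 (hh x hx).1)]
    simp only [Pi.sub_apply] at this
    rw [← sub_nonneg]
    convert this using 1
    ring
  · have := div_sub_nonneg_of_hasDerivAt hab (fun x => ((hP x).const_mul M).sub (hG x))
      fun x hx => by nlinarith [mul_nonneg (hp x hx) (sub_nonneg.2 (hh x hx).2)]
    simp only [Pi.sub_apply] at this
    rw [← sub_nonneg]
    convert this using 1
    ring

theorem normFlux_sq_div_two_eq_integral (A : ℝ → ℝ) {U C : ℝ} (h : U ≠ C) :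
    normFlux A (fun v => v ^ 2 / 2) U C
      = 2 * ∫ s in (0 : ℝ)..1, s * deriv A (C + s * (U - C)) := by
  have hUC : U - C ≠ 0 := sub_ne_zero.2 h
  have key := intervalIntegral.mul_integral_comp_add_mul (a := 0) (b := 1)
    (f := fun w => (w - C) * deriv A w) (U - C) C
  have hs : (∫ s in (0 : ℝ)..1, (C + (U - C) * s - C) * deriv A (C + (U - C) * s))
      = (U - C) * ∫ s in (0 : ℝ)..1, s * deriv A (C + s * (U - C)) := by
    rw [← intervalIntegral.integral_const_mul]
    congr 1
    ext s
    rw [mul_comm (U - C) s]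
    ring
  rw [hs, mul_zero, mul_one, add_zero, add_sub_cancel] at key
  rw [normFlux, if_neg h, relFlux_sq_div_two, relEnt_sq_div_two, ← key]
  field_simp

/-- **The quadratic entropy case.** For `η(v) = v²/2`: (a) the normalized relative entropy
flux has the representation `f(U, C) = 2 ∫₀¹ s A'(C + s(U - C)) ds`; and (b) if
`ε_A ≤ A'' ≤ L_A` on `[-R, R]`, then `(2/3) ε_A ≤ ∂f/∂U ≤ (2/3) L_A` and
`(1/3) ε_A ≤ ∂f/∂C ≤ (1/3) L_A` on `[-R, R]²` off the diagonal. -/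
theorem normFlux_quadratic_entropy
    (A : ℝ → ℝ) (hA : ContDiff ℝ (⊤ : ℕ∞) A) (hA'' : ∀ x, 0 < deriv (deriv A) x)
    (R εA LA : ℝ) (hR : 0 < R) (hεA : 0 < εA)
    (hAbd : ∀ ξ : ℝ, |ξ| ≤ R → εA ≤ deriv (deriv A) ξ ∧ deriv (deriv A) ξ ≤ LA) :
    (∀ U C : ℝ, U ≠ C →
      normFlux A (fun v => v ^ 2 / 2) U C
        = 2 * ∫ s in (0 : ℝ)..1, s * deriv A (C + s * (U - C))) ∧
    (∀ U C : ℝ, |U| ≤ R → |C| ≤ R → U ≠ C →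
      (∃ d, HasDerivAt (fun v => normFlux A (fun v => v ^ 2 / 2) v C) d U ∧
        2 / 3 * εA ≤ d ∧ d ≤ 2 / 3 * LA) ∧
      (∃ d, HasDerivAt (fun c => normFlux A (fun v => v ^ 2 / 2) U c) d C ∧
        1 / 3 * εA ≤ d ∧ d ≤ 1 / 3 * LA)) := by
  have hA1 : ∀ x, HasDerivAt A (deriv A x) x := fun x =>
    (hA.differentiable (by simp) x).hasDerivAt
  have hA2 : ∀ x, HasDerivAt (deriv A) (deriv (deriv A) x) x := fun x =>
    (((contDiff_infty_iff_deriv.1 hA).2).differentiable (by simp) x).hasDerivAt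
  obtain ⟨B, hB⟩ : ∃ B : ℝ → ℝ, ∀ x, HasDerivAt B (A x) x :=
    ⟨fun x => ∫ w in (0 : ℝ)..x, A w, fun x =>
      (hA.continuous.integral_hasStrictDerivAt 0 x).hasDerivAt⟩
  refine ⟨fun U C h => normFlux_sq_div_two_eq_integral A h, fun U C hU hC h => ?_⟩
  have hUC : U - C ≠ 0 := sub_ne_zero.2 h
  have hsq : 0 < (U - C) ^ 2 := by positivity
  have hbd : ∀ x ∈ uIcc C U, εA ≤ deriv (deriv A) x ∧ deriv (deriv A) x ≤ LA := fun x hx =>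
    hAbd x (abs_le.2 (uIcc_subset_Icc (abs_le.1 hC) (abs_le.1 hU) hx))
  constructor
  · have hG : ∀ x, HasDerivAt (fun w => (w - C) ^ 2 * deriv A w - 2 * ((w - C) * A w - B w))
        ((x - C) ^ 2 * deriv (deriv A) x) x := fun x => by
      have h1 := (hasDerivAt_id x).sub_const C
      refine HasDerivAt.congr_deriv
        (((h1.pow 2).mul (hA2 x)).sub (((h1.mul (hA1 x)).sub (hB x)).const_mul 2)) ?_
      simp
      ring
    have hP : ∀ x, HasDerivAt (fun w => (w - C) ^ 3 / 3) ((x - C) ^ 2) x := fun x => by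
      refine HasDerivAt.congr_deriv ((((hasDerivAt_id x).sub_const C).pow 3).div_const 3) ?_
      simp
    obtain ⟨hl, hu⟩ := div_sub_mem_of_hasDerivAt_mul h hG hP (fun x _ => sq_nonneg _) hbd
    have hPe : ((U - C) ^ 3 / 3 - (C - C) ^ 3 / 3) / (U - C) = (U - C) ^ 2 / 3 := by
      field_simp
      ring
    rw [hPe] at hl hu
    have h1 := (hasDerivAt_id U).sub_const C
    have hd := ((h1.mul (hA1 U)).sub ((hB U).sub_const (B C))).div ((h1.pow 2).div_const 2)
      (by simpa using hUC)
    refine ⟨_, hd.congr_of_eventuallyEq ?_, ?_⟩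
    · filter_upwards [eventually_ne_nhds h] with v hv
      rw [normFlux_sq_div_two_eq hA hB hv]
      simp
    · generalize hq : _ / (U - C) = q at hl hu
      rw [div_eq_iff hUC] at hq
      have he : ∀ d, d = 2 * q / (U - C) ^ 2 → 2 / 3 * εA ≤ d ∧ d ≤ 2 / 3 * LA := by
        rintro d rfl
        rw [le_div_iff₀ hsq, div_le_iff₀ hsq]
        constructor <;> linarith
      apply he
      simp
      field_simp
      linear_combination hq
  · have hG : ∀ x, HasDerivAt
        (fun w => (w - C) * (U - w) * deriv A w - ((U + C - 2 * w) * A w + 2 * B w))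
        ((x - C) * (U - x) * deriv (deriv A) x) x := fun x => by
      have h1 := (hasDerivAt_id x).sub_const C
      have h2 := (hasDerivAt_id x).const_sub U
      have h3 := ((hasDerivAt_id x).const_mul 2).const_sub (U + C)
      refine HasDerivAt.congr_deriv
        (((h1.mul h2).mul (hA2 x)).sub ((h3.mul (hA1 x)).add ((hB x).const_mul 2))) ?_
      simp
      ring
    have hP : ∀ x, HasDerivAt (fun w => (U - C) * (w - C) ^ 2 / 2 - (w - C) ^ 3 / 3)
        ((x - C) * (U - x)) x := fun x => by
      have h1 := (hasDerivAt_id x).sub_const C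
      refine HasDerivAt.congr_deriv
        ((((h1.pow 2).const_mul (U - C)).div_const 2).sub ((h1.pow 3).div_const 3)) ?_
      simp
      ring
    have hp : ∀ x ∈ uIcc C U, 0 ≤ (x - C) * (U - x) := fun x hx => by
      rcases mem_uIcc.1 hx with hx | hx
      · exact mul_nonneg (by linarith) (by linarith)
      · exact mul_nonneg_of_nonpos_of_nonpos (by linarith) (by linarith)
    obtain ⟨hl, hu⟩ := div_sub_mem_of_hasDerivAt_mul h hG hP hp hbd
    have hPe : ((U - C) * (U - C) ^ 2 / 2 - (U - C) ^ 3 / 3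
        - ((U - C) * (C - C) ^ 2 / 2 - (C - C) ^ 3 / 3)) / (U - C) = (U - C) ^ 2 / 6 := by
      field_simp
      ring
    rw [hPe] at hl hu
    have h1 := (hasDerivAt_id C).const_sub U
    have hd := ((h1.mul_const (A U)).sub ((hB C).const_sub (B U))).div ((h1.pow 2).div_const 2)
      (by simpa using hUC)
    refine ⟨_, hd.congr_of_eventuallyEq ?_, ?_⟩
    · filter_upwards [eventually_ne_nhds h.symm] with c hc
      rw [normFlux_sq_div_two_eq hA hB hc.symm]
      simp
    · generalize hq : _ / (U - C) = q at hl hu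
      rw [div_eq_iff hUC] at hq
      have he : ∀ d, d = 2 * q / (U - C) ^ 2 → 1 / 3 * εA ≤ d ∧ d ≤ 1 / 3 * LA := by
        rintro d rfl
        rw [le_div_iff₀ hsq, div_le_iff₀ hsq]
        constructor <;> linarith
      apply he
      simp
      field_simp
      linear_combination hq
end
end

section
/- Let A : ℝ → ℝ and η : ℝ → ℝ be smooth with A″ > 0 and η″ > 0 everywhere. Then the normalized relative entropy flux f, extended to the diagonal by f(C,C) := A′(C), is continuous at every diagonal point: for every C₀ ∈ ℝ, f(U,C) → A′(C₀) as (U,C) → (C₀,C₀). -/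
open MeasureTheory Set Filter Topology

noncomputable section

/-- Cauchy's mean value theorem without an ordering assumption on the endpoints. -/
lemma exists_ratio_hasDerivAt_eq_ratio_slope_of_ne {f f' g g' : ℝ → ℝ} {a b : ℝ} (hab : a ≠ b)
    (hf : ∀ x, HasDerivAt f (f' x) x) (hg : ∀ x, HasDerivAt g (g' x) x) :
    ∃ c ∈ Ioo (min a b) (max a b), (g b - g a) * f' c = (f b - f a) * g' c := by
  have hfc : Continuous f := continuous_iff_continuousAt.2 fun x => (hf x).continuousAt
  have hgc : Continuous g := continuous_iff_continuousAt.2 fun x => (hg x).continuousAt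
  obtain ⟨c, hc, h⟩ := exists_ratio_hasDerivAt_eq_ratio_slope f f' (min_lt_max.2 hab)
    hfc.continuousOn (fun x _ => hf x) g g' hgc.continuousOn (fun x _ => hg x)
  refine ⟨c, hc, ?_⟩
  rcases le_total a b with hle | hle
  · simpa [hle] using h
  · simp only [hle, min_eq_right, max_eq_left] at h
    linarith

lemma hasDerivAt_relEnt {η : ℝ → ℝ} (hη : Differentiable ℝ η) (C v : ℝ) :
    HasDerivAt (fun v => relEnt η v C) (deriv η v - deriv η C) v := by
  have h := ((hη v).hasDerivAt.sub_const (η C)).sub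
    (((hasDerivAt_id v).sub_const C).const_mul (deriv η C))
  rw [mul_one] at h
  exact h

/-- The normalized relative entropy flux is a value of `A'` between its two arguments. -/
lemma exists_mem_uIcc_normFlux_eq_deriv {A η : ℝ → ℝ} (hA : Continuous (deriv A))
    (hη : Differentiable ℝ η) (hη' : Continuous (deriv η)) (hmono : StrictMono (deriv η))
    (v C : ℝ) : ∃ c ∈ uIcc v C, normFlux A η v C = deriv A c := by
  by_cases hvC : v = C
  · exact ⟨C, right_mem_uIcc, by simp [normFlux, hvC]⟩
  have hne : ∀ c ∈ Ioo (min C v) (max C v), deriv η c - deriv η C ≠ 0 := by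
    intro c hc h
    have hcC : c = C := hmono.injective (sub_eq_zero.1 h)
    subst hcC
    rcases le_total c v with hle | hle <;> simp [hle] at hc
  have hE0 : relEnt η C C = 0 := by simp [relEnt]
  have hF0 : relFlux A η C C = 0 := by simp [relFlux]
  have hE : relEnt η v C ≠ 0 := by
    intro h
    obtain ⟨c, hc, hslope⟩ := exists_ratio_hasDerivAt_eq_ratio_slope_of_ne (Ne.symm hvC)
      (hasDerivAt_relEnt hη C) hasDerivAt_id
    simp only [hE0, h, sub_zero, zero_mul, id_eq, mul_eq_zero, sub_eq_zero, hvC, false_or] at hslope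
    exact hne c hc (sub_eq_zero.2 hslope)
  obtain ⟨c, hc, hslope⟩ := exists_ratio_hasDerivAt_eq_ratio_slope_of_ne (Ne.symm hvC)
    (hasDerivAt_relFlux hA hη' C) (hasDerivAt_relEnt hη C)
  refine ⟨c, by rw [uIcc_comm]; exact Ioo_subset_Icc_self hc, ?_⟩
  simp only [hE0, hF0, sub_zero] at hslope
  rw [normFlux, if_neg hvC, div_eq_iff hE]
  apply mul_right_cancel₀ (hne c hc)
  linarith

/-- **Continuity of `f` at the diagonal.** The normalized relative entropy flux, extended by
`f(C, C) = A'(C)`, satisfies `f(U, C) → A'(C₀)` as `(U, C) → (C₀, C₀)`. -/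
theorem normFlux_continuous_diagonal
    (A η : ℝ → ℝ) (hA : ContDiff ℝ (⊤ : ℕ∞) A) (hη : ContDiff ℝ (⊤ : ℕ∞) η)
    (hA'' : ∀ x, 0 < deriv (deriv A) x) (hη'' : ∀ x, 0 < deriv (deriv η) x)
    (C₀ : ℝ) :
    Tendsto (fun p : ℝ × ℝ => normFlux A η p.1 p.2) (𝓝 (C₀, C₀)) (𝓝 (deriv A C₀)) := by
  have hA' : Continuous (deriv A) := hA.continuous_deriv (by simp)
  choose c hc hfc using fun p : ℝ × ℝ => exists_mem_uIcc_normFlux_eq_deriv hA'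
    (hη.differentiable (by simp)) (hη.continuous_deriv (by simp))
    (strictMono_of_deriv_pos hη'') p.1 p.2
  simp only [hfc]
  refine (hA'.tendsto C₀).comp (tendsto_of_tendsto_of_tendsto_of_le_of_le
    (g := fun p : ℝ × ℝ => min p.1 p.2) (h := fun p : ℝ × ℝ => max p.1 p.2) ?_ ?_
    (fun p => (hc p).1) (fun p => (hc p).2))
  · simpa using (continuous_fst.min continuous_snd).tendsto (C₀, C₀)
  · simpa using (continuous_fst.max continuous_snd).tendsto (C₀, C₀)
end
end

section
/- Let U be an entropy solution of ∂_t U + ∂_x A(U) = 0 admitting one-sided spatial limits, and let x : [t₀,T] → ℝ, 0 ≤ t₀ < T < ∞, be a Lipschitz continuous function. Then for almost all t ∈ [t₀,T]: A(U(x(t)+,t)) − A(U(x(t)−,t)) − ẋ(t)[U(x(t)+,t) − U(x(t)−,t)] = 0, where ẋ denotes the almost-everywhere defined derivative of x. -/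
open MeasureTheory Set Filter Topology

noncomputable section

open scoped Convolution ContDiff

/-- A globally Lipschitz real function is the pointwise limit of smooth functions whose derivatives
are uniformly bounded and converge almost everywhere. -/
theorem LipschitzWith.exists_smooth_approx {x : ℝ → ℝ} {K : NNReal} (hx : LipschitzWith K x) :
    ∃ (c : ℕ → ℝ → ℝ) (B : ℝ), (∀ n, ContDiff ℝ (⊤ : ℕ∞) (c n)) ∧
      (∀ t, Tendsto (fun n => c n t) atTop (𝓝 (x t))) ∧
      (∀ n t, |deriv (c n) t| ≤ B) ∧
      ∀ᵐ t, Tendsto (fun n => deriv (c n) t) atTop (𝓝 (deriv x t)) := by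
  have hgm : Measurable (deriv x) := measurable_deriv x
  have hgb : ∀ t, |deriv x t| ≤ K := fun t => norm_deriv_le_of_lipschitz hx
  have hgl : LocallyIntegrable (deriv x) volume := by
    refine (locallyIntegrable_const (K : ℝ)).mono hgm.aestronglyMeasurable (ae_of_all _ fun t => ?_)
    simpa using hgb t
  let φ : ℕ → ContDiffBump (0 : ℝ) := fun n =>
    ⟨1 / ((n : ℝ) + 1), 2 * (1 / ((n : ℝ) + 1)), by positivity, by
      have : (0 : ℝ) < 1 / ((n : ℝ) + 1) := by positivity
      linarith⟩
  let g : ℕ → ℝ → ℝ := fun n =>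
    ((φ n).normed volume ⋆[ContinuousLinearMap.lsmul ℝ ℝ, volume] deriv x)
  have hgs : ∀ n, ContDiff ℝ (⊤ : ℕ∞) (g n) := fun n =>
    HasCompactSupport.contDiff_convolution_left _ (φ n).hasCompactSupport_normed
      (φ n).contDiff_normed hgl
  have hgn : ∀ᵐ t, Tendsto (fun n => g n t) atTop (𝓝 (deriv x t)) := by
    refine ContDiffBump.ae_convolution_tendsto_right_of_locallyIntegrable (K := 2) ?_
      (Eventually.of_forall fun n => le_rfl) hgl
    simpa only [mul_zero] using (tendsto_one_div_add_atTop_nhds_zero_nat (𝕜 := ℝ)).const_mul 2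
  have hgB : ∀ n t, |g n t| ≤ 3 * K := by
    intro n t
    have h := (φ n).dist_normed_convolution_le (μ := volume) (g := deriv x) (x₀ := t)
      (ε := 2 * K) hgm.aestronglyMeasurable (fun s _ => by
        rw [Real.dist_eq]
        have := abs_sub (deriv x s) (deriv x t)
        linarith [hgb s, hgb t])
    rw [Real.dist_eq] at h
    have h1 := abs_sub_abs_le_abs_sub (g n t) (deriv x t)
    have h2 := hgb t
    have h3 : |g n t - deriv x t| ≤ 2 * K := h
    linarith
  have hd : ∀ n t, HasDerivAt (fun t => x 0 + ∫ s in (0 : ℝ)..t, g n s) (g n t) t := fun n t =>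
    ((hgs n).continuous.integral_hasStrictDerivAt 0 t).hasDerivAt.const_add _
  have hderiv : ∀ n, deriv (fun t => x 0 + ∫ s in (0 : ℝ)..t, g n s) = g n := fun n =>
    funext fun t => (hd n t).deriv
  refine ⟨fun n t => x 0 + ∫ s in (0 : ℝ)..t, g n s, 3 * K, fun n => ?_, fun t => ?_,
    fun n t => ?_, ?_⟩
  · rw [contDiff_infty_iff_deriv, hderiv]
    exact ⟨fun t => (hd n t).differentiableAt, hgs n⟩
  · have hac : AbsolutelyContinuousOnInterval x 0 t :=
      (hx.lipschitzOnWith (s := uIcc 0 t)).absolutelyContinuousOnInterval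
    have hftc : x t = x 0 + ∫ s in (0 : ℝ)..t, deriv x s := by
      rw [hac.integral_deriv_eq_sub]; ring
    rw [hftc]
    refine Tendsto.const_add _ (intervalIntegral.tendsto_integral_filter_of_dominated_convergence
      (fun _ => 3 * (K : ℝ)) (Eventually.of_forall fun n => (hgs n).continuous.aestronglyMeasurable)
      (Eventually.of_forall fun n => ae_of_all _ fun s _ => hgB n s)
      intervalIntegrable_const ?_)
    filter_upwards [hgn] with s hs _ using hs
  · rw [hderiv]; exact hgB n t
  · simpa only [hderiv] using hgn

/-- The integral of `V` against the translate of the window `k` to the point `c`. -/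
def windowIntegral (k V : ℝ → ℝ) (c : ℝ) : ℝ := ∫ y, V y * k (y - c)

section Window

variable {k V : ℝ → ℝ} {M : ℝ}

theorem integrable_mul_window (hk : Continuous k) (hks : HasCompactSupport k) (hV : Measurable V)
    (hM : ∀ y, |V y| ≤ M) (c : ℝ) : Integrable fun y => V y * k (y - c) :=
  ((hk.integrable_of_hasCompactSupport hks).comp_sub_right c).bdd_mul
    hV.aestronglyMeasurable (ae_of_all _ hM)

theorem continuous_windowIntegral (hk : Continuous k) (hks : HasCompactSupport k)
    (hV : Measurable V) (hM : ∀ y, |V y| ≤ M) : Continuous (windowIntegral k V) := by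
  have hVl : LocallyIntegrable V volume :=
    (locallyIntegrable_const M).mono hV.aestronglyMeasurable
      (ae_of_all _ fun y => (hM y).trans (le_abs_self M))
  have h := HasCompactSupport.continuous_convolution_right (μ := volume) (ContinuousLinearMap.mul ℝ ℝ)
    (g := fun z => k (-z)) (hks.comp_homeomorph (Homeomorph.neg ℝ)) hVl (hk.comp continuous_neg)
  convert h using 1
  ext c
  simp [windowIntegral, convolution]

theorem abs_windowIntegral_le (hk : Continuous k) (hks : HasCompactSupport k)
    (hM : ∀ y, |V y| ≤ M) (c : ℝ) : |windowIntegral k V c| ≤ M * ∫ y, |k y| := by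
  have hki : Integrable (fun y => M * |k (y - c)|) :=
    ((hk.integrable_of_hasCompactSupport hks).comp_sub_right c).abs.const_mul M
  calc |windowIntegral k V c| = ‖∫ y, V y * k (y - c)‖ := rfl
    _ ≤ ∫ y, M * |k (y - c)| :=
        norm_integral_le_of_norm_le hki (ae_of_all _ fun y => by
          rw [norm_mul]; exact mul_le_mul_of_nonneg_right (hM y) (abs_nonneg _))
    _ = M * ∫ y, |k y| := by
        rw [integral_const_mul, integral_sub_right_eq_self (fun y => |k y|) c]

theorem windowIntegral_scale (m : ℝ) (hm : 0 < m) (c : ℝ) :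
    windowIntegral (fun z => m * k (m * z)) V c = ∫ z, V (c + z / m) * k z := by
  have h1 := integral_sub_right_eq_self (μ := volume) (fun z => V (c + z) * (m * k (m * z))) c
  have h2 := Measure.integral_comp_mul_left (fun z => V (c + z / m) * k z) m
  rw [windowIntegral]
  calc _ = ∫ z, V (c + z) * (m * k (m * z)) := by
        rw [← h1]; congr 1; ext y; rw [add_sub_cancel]
    _ = m * ∫ z, V (c + (m * z) / m) * k (m * z) := by
        rw [← integral_const_mul]; congr 1; ext z; rw [mul_div_cancel_left₀ _ hm.ne']; ring
    _ = _ := by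
        rw [h2, abs_of_pos (inv_pos.2 hm), smul_eq_mul, ← mul_assoc, mul_inv_cancel₀ hm.ne', one_mul]

theorem abs_windowIntegral_scale_le (hk : Continuous k) (hks : HasCompactSupport k)
    (hM : ∀ y, |V y| ≤ M) (m : ℝ) (hm : 0 < m) (c : ℝ) :
    |windowIntegral (fun z => m * k (m * z)) V c| ≤ M * ∫ z, |k z| := by
  rw [windowIntegral_scale m hm, ← integral_const_mul, ← Real.norm_eq_abs]
  refine norm_integral_le_of_norm_le
    ((hk.integrable_of_hasCompactSupport (μ := volume) hks).abs.const_mul M) (ae_of_all _ fun z => ?_)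
  rw [norm_mul]
  exact mul_le_mul_of_nonneg_right (hM _) (abs_nonneg _)

theorem tendsto_windowIntegral_scale (hk : Continuous k) (hks : HasCompactSupport k)
    (hV : Measurable V) (hM : ∀ y, |V y| ≤ M) {c l r : ℝ} (hl : Tendsto V (𝓝[<] c) (𝓝 l))
    (hr : Tendsto V (𝓝[>] c) (𝓝 r)) :
    Tendsto (fun n : ℕ => windowIntegral (fun z => ((n : ℝ) + 1) * k (((n : ℝ) + 1) * z)) V c)
      atTop (𝓝 (l * (∫ z in Iic 0, k z) + r * ∫ z in Ioi 0, k z)) := by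
  have hki := hk.integrable_of_hasCompactSupport (μ := volume) hks
  have hlim : l * (∫ z in Iic 0, k z) + r * (∫ z in Ioi 0, k z)
      = ∫ z, (if z ≤ 0 then l else r) * k z := by
    have hi : Integrable fun z => (if z ≤ 0 then l else r) * k z := by
      refine hki.bdd_mul (c := max |l| |r|) (Measurable.aestronglyMeasurable
        (Measurable.ite measurableSet_Iic measurable_const measurable_const))
        (ae_of_all _ fun z => ?_)
      split_ifs <;> simp
    rw [← integral_add_compl measurableSet_Iic hi (s := Iic 0), compl_Iic,
      ← integral_const_mul, ← integral_const_mul]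
    congr 1
    · exact setIntegral_congr_fun measurableSet_Iic fun z (hz : z ≤ 0) => by simp [hz]
    · exact setIntegral_congr_fun measurableSet_Ioi fun z (hz : 0 < z) => by simp [hz.not_ge]
  rw [hlim]
  have hpos : ∀ n : ℕ, (0 : ℝ) < (n : ℝ) + 1 := fun n => by positivity
  simp_rw [fun n : ℕ => windowIntegral_scale (k := k) (V := V) _ (hpos n) c]
  refine tendsto_integral_of_dominated_convergence (fun z => M * |k z|)
    (fun n => ((hV.comp (by fun_prop)).mul hk.measurable).aestronglyMeasurable)
    (hki.abs.const_mul M) (fun n => ae_of_all _ fun z => ?_) ?_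
  · rw [norm_mul]; exact mul_le_mul_of_nonneg_right (hM _) (abs_nonneg _)
  · have h0 : ∀ᵐ z : ℝ, z ≠ 0 := by simp [ae_iff, measure_singleton]
    filter_upwards [h0] with z hz
    have hc : Tendsto (fun n : ℕ => c + z / ((n : ℝ) + 1)) atTop (𝓝 c) := by
      have := ((tendsto_one_div_add_atTop_nhds_zero_nat (𝕜 := ℝ)).const_mul z).const_add c
      simpa [div_eq_mul_inv] using this
    refine Tendsto.mul_const _ ?_
    rcases hz.lt_or_gt with hz | hz
    · rw [if_pos hz.le]
      exact hl.comp (tendsto_nhdsWithin_iff.2 ⟨hc, Eventually.of_forall fun n => by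
        have := div_neg_of_neg_of_pos hz (hpos n); simpa using this⟩)
    · rw [if_neg hz.not_ge]
      exact hr.comp (tendsto_nhdsWithin_iff.2 ⟨hc, Eventually.of_forall fun n => by
        have := div_pos hz (hpos n); simpa using this⟩)

end Window

theorem stronglyMeasurable_windowIntegral {k : ℝ → ℝ} {V : ℝ → ℝ → ℝ} {x : ℝ → ℝ}
    (hk : Continuous k) (hV : Measurable fun p : ℝ × ℝ => V p.1 p.2) (hx : Continuous x) :
    StronglyMeasurable fun t => windowIntegral k (fun y => V y t) (x t) := by
  refine StronglyMeasurable.integral_prod_right (f := fun t y => V y t * k (y - x t))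
    (Measurable.stronglyMeasurable ?_)
  exact (hV.comp measurable_swap).mul (hk.comp (by fun_prop)).measurable

namespace IsEntropySol

variable {A : ℝ → ℝ} {U : ℝ → ℝ → ℝ}

theorem measurable_slice (hsol : IsEntropySol A U) (t : ℝ) : Measurable fun y => U y t :=
  hsol.measurable.comp (measurable_id.prodMk measurable_const)

theorem exists_flux_bound (hsol : IsEntropySol A U) (hA : Continuous A) :
    ∃ M, ∀ y t, |A (U y t)| ≤ M := by
  obtain ⟨M, hM⟩ := hsol.bounded
  obtain ⟨C, hC⟩ := (isCompact_Icc (a := -M) (b := M)).exists_bound_of_continuousOn hA.continuousOn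
  exact ⟨C, fun y t => hC _ (abs_le.1 (hM y t))⟩

/-- An entropy solution is a weak solution. -/
theorem weak_formulation (hsol : IsEntropySol A U) (hA : ContDiff ℝ (⊤ : ℕ∞) A)
    (θ : ℝ → ℝ → ℝ) (hθ : ContDiff ℝ (⊤ : ℕ∞) (fun p : ℝ × ℝ => θ p.1 p.2))
    (hθs : HasCompactSupport (fun p : ℝ × ℝ => θ p.1 p.2)) (hθ0 : ∀ x t, 0 ≤ θ x t)
    (hθt : ∀ x t, t ≤ 0 → θ x t = 0) :
    ∫ t in Ioi (0 : ℝ), ∫ x : ℝ,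
      (U x t * deriv (fun s => θ x s) t + A (U x t) * deriv (fun y => θ y t) x) = 0 := by
  have h1 := hsol.entropy id A contDiff_id hA (by simp) (by simp) θ hθ hθs hθ0 hθt
  have h2 := hsol.entropy (fun v => -v) (fun v => -A v) contDiff_neg hA.neg (by simp) (by simp)
    θ hθ hθs hθ0 hθt
  simp only [id, neg_mul, ← neg_add, integral_neg] at h1 h2
  linarith

section Curve

variable {φ ψ : ℝ → ℝ}

/-- The weak formulation tested against `φ(t) ψ(y - c(t))`, for a smooth curve `c`. -/
theorem weak_along_smooth_curve (hsol : IsEntropySol A U) (hA : ContDiff ℝ (⊤ : ℕ∞) A)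
    (hφ : ContDiff ℝ (⊤ : ℕ∞) φ) (hφs : HasCompactSupport φ) (hφ0 : ∀ t, 0 ≤ φ t)
    (hφt : ∀ t ≤ 0, φ t = 0)
    (hψ : ContDiff ℝ (⊤ : ℕ∞) ψ) (hψs : HasCompactSupport ψ) (hψ0 : ∀ z, 0 ≤ ψ z)
    {c : ℝ → ℝ} (hc : ContDiff ℝ (⊤ : ℕ∞) c) :
    ∫ t in Ioi (0 : ℝ), (deriv φ t * windowIntegral ψ (fun y => U y t) (c t) +
      φ t * (windowIntegral (deriv ψ) (fun y => A (U y t)) (c t) -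
        deriv c t * windowIntegral (deriv ψ) (fun y => U y t) (c t))) = 0 := by
  obtain ⟨M, hM⟩ := hsol.bounded
  obtain ⟨N, hN⟩ := hsol.exists_flux_bound hA.continuous
  have hne : ((⊤ : ℕ∞) : WithTop ℕ∞) ≠ 0 := by simp
  have hcd := hc.differentiable hne
  have hψd := hψ.differentiable hne
  have hφd := hφ.differentiable hne
  have hψ' : Continuous (deriv ψ) := hψ.continuous_deriv (by simp)
  have hsupp : HasCompactSupport (fun p : ℝ × ℝ => φ p.2 * ψ (p.1 - c p.2)) := by
    refine HasCompactSupport.intro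
      (K := (fun q : ℝ × ℝ => (q.2 + c q.1, q.1)) '' (tsupport φ ×ˢ tsupport ψ))
      ((hφs.isCompact.prod hψs.isCompact).image ?_) fun p hp => ?_
    · have := hc.continuous
      fun_prop
    · by_contra h
      obtain ⟨h1, h2⟩ := mul_ne_zero_iff.1 h
      exact hp ⟨(p.2, p.1 - c p.2), ⟨subset_tsupport _ h1, subset_tsupport _ h2⟩, by simp⟩
  have key := hsol.weak_formulation hA (fun y t => φ t * ψ (y - c t)) (by fun_prop) hsupp
    (fun y t => mul_nonneg (hφ0 t) (hψ0 _)) (fun y t ht => by simp [hφt t ht])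
  refine Eq.trans ?_ key
  refine integral_congr_ae (ae_of_all _ fun t => ?_)
  have hdt : ∀ y, deriv (fun s => φ s * ψ (y - c s)) t
      = deriv φ t * ψ (y - c t) - φ t * (deriv c t * deriv ψ (y - c t)) := fun y => by
    have h := (hφd t).hasDerivAt.mul
      ((hψd (y - c t)).hasDerivAt.comp t ((hcd t).hasDerivAt.const_sub y))
    refine h.deriv.trans ?_
    simp only [Function.comp_apply]; ring
  have hdy : ∀ y, deriv (fun y => φ t * ψ (y - c t)) y = φ t * deriv ψ (y - c t) := fun y => by
    rw [deriv_const_mul _ (by fun_prop), deriv_comp_sub_const]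
  have hU := hsol.measurable_slice t
  have i1 := (integrable_mul_window hψ.continuous hψs hU (fun y => hM y t) (c t)).const_mul
    (deriv φ t)
  have i2 := (integrable_mul_window hψ' hψs.deriv (hA.continuous.measurable.comp hU)
    (fun y => hN y t) (c t)).const_mul (φ t)
  have i3 := (integrable_mul_window hψ' hψs.deriv hU (fun y => hM y t) (c t)).const_mul
    (φ t * deriv c t)
  simp only [windowIntegral, hdt, hdy]
  rw [mul_sub, ← mul_assoc (φ t) (deriv c t), ← integral_const_mul, ← integral_const_mul,
    ← integral_const_mul]
  simp only [Function.comp_apply] at i2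
  rw [← integral_sub i2 i3]
  refine (integral_add i1 (i2.sub i3)).symm.trans ?_
  congr 1; ext y; simp only [Pi.sub_apply]; ring

/-- The weak formulation tested against `φ(t) ψ(y - x(t))`, for a Lipschitz curve `x`. -/
theorem weak_along_lipschitz_curve (hsol : IsEntropySol A U) (hA : ContDiff ℝ (⊤ : ℕ∞) A)
    (hφ : ContDiff ℝ (⊤ : ℕ∞) φ) (hφs : HasCompactSupport φ) (hφ0 : ∀ t, 0 ≤ φ t)
    (hφt : ∀ t ≤ 0, φ t = 0)
    (hψ : ContDiff ℝ (⊤ : ℕ∞) ψ) (hψs : HasCompactSupport ψ) (hψ0 : ∀ z, 0 ≤ ψ z)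
    {x : ℝ → ℝ} {K : NNReal} (hx : LipschitzWith K x) :
    ∫ t in Ioi (0 : ℝ), (deriv φ t * windowIntegral ψ (fun y => U y t) (x t) +
      φ t * (windowIntegral (deriv ψ) (fun y => A (U y t)) (x t) -
        deriv x t * windowIntegral (deriv ψ) (fun y => U y t) (x t))) = 0 := by
  obtain ⟨M, hM⟩ := hsol.bounded
  obtain ⟨N, hN⟩ := hsol.exists_flux_bound hA.continuous
  obtain ⟨c, B, hc, hcx, hcB, hcd⟩ := hx.exists_smooth_approx
  have hψ' : Continuous (deriv ψ) := hψ.continuous_deriv (by simp)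
  have hφ' : Continuous (deriv φ) := hφ.continuous_deriv (by simp)
  have hAU : Measurable fun p : ℝ × ℝ => A (U p.1 p.2) :=
    hA.continuous.measurable.comp hsol.measurable
  refine tendsto_nhds_unique (tendsto_integral_of_dominated_convergence (G := ℝ)
    (μ := volume.restrict (Ioi 0)) (F := fun n t =>
    deriv φ t * windowIntegral ψ (fun y => U y t) (c n t) +
      φ t * (windowIntegral (deriv ψ) (fun y => A (U y t)) (c n t) -
        deriv (c n) t * windowIntegral (deriv ψ) (fun y => U y t) (c n t)))
    (fun t => |deriv φ t| * (M * ∫ z, |ψ z|) +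
      |φ t| * ((N * ∫ z, |deriv ψ z|) + B * (M * ∫ z, |deriv ψ z|))) (fun n => ?_) ?_
    (fun n => ae_of_all _ fun t => ?_) (ae_restrict_of_ae ?_)) ?_
  · have hcn := (hc n).continuous
    exact ((hφ'.stronglyMeasurable.mul (stronglyMeasurable_windowIntegral hψ.continuous
      hsol.measurable hcn)).add (hφ.continuous.stronglyMeasurable.mul
      ((stronglyMeasurable_windowIntegral hψ' (V := fun y t => A (U y t)) hAU hcn).sub
        (((hc n).continuous_deriv (by simp)).stronglyMeasurable.mul
          (stronglyMeasurable_windowIntegral hψ' hsol.measurable hcn))))).aestronglyMeasurable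
  · exact (((hφ'.integrable_of_hasCompactSupport hφs.deriv).abs.mul_const _).add
      ((hφ.continuous.integrable_of_hasCompactSupport hφs).abs.mul_const _)).restrict
  · have h1 := abs_windowIntegral_le hψ.continuous hψs (fun y => hM y t) (c n t)
    have h2 := abs_windowIntegral_le hψ' hψs.deriv (fun y => hN y t) (c n t)
    have h3 := abs_windowIntegral_le hψ' hψs.deriv (fun y => hM y t) (c n t)
    refine (abs_add_le _ _).trans ?_
    rw [abs_mul, abs_mul (φ t)]
    refine add_le_add (mul_le_mul_of_nonneg_left h1 (abs_nonneg _))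
      (mul_le_mul_of_nonneg_left ((abs_sub _ _).trans (add_le_add h2 ?_)) (abs_nonneg _))
    rw [abs_mul]
    exact mul_le_mul (hcB n t) h3 (abs_nonneg _) ((abs_nonneg _).trans (hcB n t))
  · filter_upwards [hcd] with t ht
    have hU := hsol.measurable_slice t
    have hw := fun {k : ℝ → ℝ} (hk : Continuous k) (hks : HasCompactSupport k) =>
      ((continuous_windowIntegral hk hks hU (fun y => hM y t)).tendsto (x t)).comp (hcx t)
    have hwA := ((continuous_windowIntegral hψ' hψs.deriv (hA.continuous.measurable.comp hU)
      (fun y => hN y t)).tendsto (x t)).comp (hcx t)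
    exact ((hw hψ.continuous hψs).const_mul _).add
      ((hwA.sub (ht.mul (hw hψ' hψs.deriv))).const_mul _)
  · simp_rw [fun n => hsol.weak_along_smooth_curve hA hφ hφs hφ0 hφt hψ hψs hψ0 (hc n)]
    exact tendsto_const_nhds

end Curve

end IsEntropySol

theorem HasSideLimits.abs_le {U Um Up : ℝ → ℝ → ℝ} (hlim : HasSideLimits U Um Up) {M : ℝ}
    (hM : ∀ y t, |U y t| ≤ M) (y : ℝ) {t : ℝ} (ht : 0 < t) : |Um y t| ≤ M ∧ |Up y t| ≤ M :=
  ⟨le_of_tendsto (hlim.left y t ht).abs (Eventually.of_forall fun _ => hM _ _),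
    le_of_tendsto (hlim.right y t ht).abs (Eventually.of_forall fun _ => hM _ _)⟩

theorem HasSideLimits.aestronglyMeasurable {U Um Up : ℝ → ℝ → ℝ} (hlim : HasSideLimits U Um Up)
    (hU : Measurable fun p : ℝ × ℝ => U p.1 p.2) {x : ℝ → ℝ} (hx : Continuous x) :
    AEStronglyMeasurable (fun t => Um (x t) t) (volume.restrict (Ioi 0)) ∧
      AEStronglyMeasurable (fun t => Up (x t) t) (volume.restrict (Ioi 0)) := by
  have hpos : ∀ n : ℕ, (0 : ℝ) < 1 / ((n : ℝ) + 1) := fun n => by positivity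
  have h0 := tendsto_one_div_add_atTop_nhds_zero_nat (𝕜 := ℝ)
  constructor
  · refine aestronglyMeasurable_of_tendsto_ae atTop
      (f := fun (n : ℕ) t => U (x t - 1 / ((n : ℝ) + 1)) t) (fun n => ?_)
      (ae_restrict_of_forall_mem measurableSet_Ioi fun t ht => ?_)
    · exact (hU.comp (g := fun p : ℝ × ℝ => U p.1 p.2)
        ((hx.measurable.sub_const _).prodMk measurable_id)).aestronglyMeasurable
    · refine (hlim.left (x t) t ht).comp (tendsto_nhdsWithin_iff.2 ⟨?_, ?_⟩)
      · simpa only [sub_zero] using h0.const_sub (x t)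
      · exact Eventually.of_forall fun n => sub_lt_self _ (hpos n)
  · refine aestronglyMeasurable_of_tendsto_ae atTop
      (f := fun (n : ℕ) t => U (x t + 1 / ((n : ℝ) + 1)) t) (fun n => ?_)
      (ae_restrict_of_forall_mem measurableSet_Ioi fun t ht => ?_)
    · exact (hU.comp (g := fun p : ℝ × ℝ => U p.1 p.2)
        ((hx.measurable.add_const _).prodMk measurable_id)).aestronglyMeasurable
    · refine (hlim.right (x t) t ht).comp (tendsto_nhdsWithin_iff.2 ⟨?_, ?_⟩)
      · simpa only [add_zero] using h0.const_add (x t)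
      · exact Eventually.of_forall fun n => lt_add_of_pos_right _ (hpos n)

/-- The defect in the Rankine–Hugoniot condition along the curve `x` at time `t`. -/
def rankineHugoniotDefect (A : ℝ → ℝ) (Um Up : ℝ → ℝ → ℝ) (x : ℝ → ℝ) (t : ℝ) : ℝ :=
  A (Up (x t) t) - A (Um (x t) t) - deriv x t * (Up (x t) t - Um (x t) t)

namespace IsEntropySol

variable {A : ℝ → ℝ} {U Um Up : ℝ → ℝ → ℝ}

/-- The Rankine–Hugoniot condition in integrated form. -/
theorem integral_mul_rankineHugoniotDefect (hsol : IsEntropySol A U) (hA : ContDiff ℝ (⊤ : ℕ∞) A)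
    (hlim : HasSideLimits U Um Up) {φ : ℝ → ℝ}
    (hφ : ContDiff ℝ (⊤ : ℕ∞) φ) (hφs : HasCompactSupport φ) (hφ0 : ∀ t, 0 ≤ φ t)
    (hφt : ∀ t ≤ 0, φ t = 0) {x : ℝ → ℝ} {K : NNReal} (hx : LipschitzWith K x) :
    ∫ t in Ioi (0 : ℝ), φ t * rankineHugoniotDefect A Um Up x t = 0 := by
  obtain ⟨M, hM⟩ := hsol.bounded
  obtain ⟨N, hN⟩ := hsol.exists_flux_bound hA.continuous
  obtain ⟨ψ, hψ, hψs, hψ0, hψ1⟩ : ∃ ψ : ℝ → ℝ, ContDiff ℝ (⊤ : ℕ∞) ψ ∧ HasCompactSupport ψ ∧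
      (∀ z, 0 ≤ ψ z) ∧ ψ 0 = 1 := by
    let b : ContDiffBump (0 : ℝ) := ⟨1, 2, one_pos, one_lt_two⟩
    exact ⟨b, b.contDiff, b.hasCompactSupport, fun _ => b.nonneg, b.one_of_mem_closedBall (by simp [b])⟩
  have hψ' : Continuous (deriv ψ) := hψ.continuous_deriv (by simp)
  have hφ' : Continuous (deriv φ) := hφ.continuous_deriv (by simp)
  have hAU : Measurable fun p : ℝ × ℝ => A (U p.1 p.2) :=
    hA.continuous.measurable.comp hsol.measurable
  have hIic : ∫ z in Iic 0, deriv ψ z = 1 := by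
    rw [HasCompactSupport.integral_Iic_deriv_eq (hψ.of_le (by simp)) hψs, hψ1]
  have hIoi : ∫ z in Ioi 0, deriv ψ z = -1 := by
    rw [HasCompactSupport.integral_Ioi_deriv_eq (hψ.of_le (by simp)) hψs, hψ1]
  have hpos : ∀ n : ℕ, (0 : ℝ) < (n : ℝ) + 1 := fun n => by positivity
  have hψ'n : ∀ n : ℕ, deriv (fun z => ψ (((n : ℝ) + 1) * z)) =
      fun z => ((n : ℝ) + 1) * deriv ψ (((n : ℝ) + 1) * z) := fun n => by
    ext z; rw [deriv_comp_mul_left, smul_eq_mul]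
  have hψn : ∀ (n : ℕ) (V : ℝ → ℝ) (c : ℝ), windowIntegral (fun z => ψ (((n : ℝ) + 1) * z)) V c =
      1 / ((n : ℝ) + 1) *
        windowIntegral (fun z => ((n : ℝ) + 1) * ψ (((n : ℝ) + 1) * z)) V c := fun n V c => by
    simp only [windowIntegral]
    rw [← integral_const_mul]
    congr 1; ext y
    have := (hpos n).ne'
    field_simp
  have hweak : ∀ n : ℕ, ∫ t in Ioi (0 : ℝ), (deriv φ t * (1 / ((n : ℝ) + 1) *
        windowIntegral (fun z => ((n : ℝ) + 1) * ψ (((n : ℝ) + 1) * z)) (fun y => U y t) (x t)) +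
      φ t * (windowIntegral (fun z => ((n : ℝ) + 1) * deriv ψ (((n : ℝ) + 1) * z))
          (fun y => A (U y t)) (x t) -
        deriv x t * windowIntegral (fun z => ((n : ℝ) + 1) * deriv ψ (((n : ℝ) + 1) * z))
          (fun y => U y t) (x t))) = 0 := fun n => by
    have h := hsol.weak_along_lipschitz_curve hA hφ hφs hφ0 hφt
      (ψ := fun z => ψ (((n : ℝ) + 1) * z)) (by fun_prop)
      (hψs.comp_homeomorph (Homeomorph.mulLeft₀ ((n : ℝ) + 1) (hpos n).ne'))
      (fun z => hψ0 _) hx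
    simpa only [hψ'n, hψn] using h
  rw [← neg_eq_zero, ← integral_neg]
  refine tendsto_nhds_unique (tendsto_integral_of_dominated_convergence (G := ℝ)
    (μ := volume.restrict (Ioi 0)) (F := fun (n : ℕ) t =>
      deriv φ t * (1 / ((n : ℝ) + 1) *
        windowIntegral (fun z => ((n : ℝ) + 1) * ψ (((n : ℝ) + 1) * z)) (fun y => U y t) (x t)) +
      φ t * (windowIntegral (fun z => ((n : ℝ) + 1) * deriv ψ (((n : ℝ) + 1) * z))
          (fun y => A (U y t)) (x t) -
        deriv x t * windowIntegral (fun z => ((n : ℝ) + 1) * deriv ψ (((n : ℝ) + 1) * z))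
          (fun y => U y t) (x t)))
    (f := fun t => -(φ t * rankineHugoniotDefect A Um Up x t))
    (fun t => |deriv φ t| * (1 * (M * ∫ z, |ψ z|)) +
      |φ t| * ((N * ∫ z, |deriv ψ z|) + K * (M * ∫ z, |deriv ψ z|))) (fun n => ?_) ?_
    (fun n => ae_of_all _ fun t => ?_)
    (ae_restrict_of_forall_mem measurableSet_Ioi fun t ht => ?_)) ?_
  · have h1 := stronglyMeasurable_windowIntegral (x := x)
      (k := fun z => ((n : ℝ) + 1) * ψ (((n : ℝ) + 1) * z))
      (by have := hψ.continuous; fun_prop) hsol.measurable hx.continuous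
    have hk : Continuous fun z => ((n : ℝ) + 1) * deriv ψ (((n : ℝ) + 1) * z) := by fun_prop
    have h2 := stronglyMeasurable_windowIntegral (V := fun y t => A (U y t)) hk hAU hx.continuous
    have h3 := stronglyMeasurable_windowIntegral hk hsol.measurable hx.continuous
    exact ((hφ'.stronglyMeasurable.mul (h1.const_mul _)).add (hφ.continuous.stronglyMeasurable.mul
      (h2.sub ((measurable_deriv x).stronglyMeasurable.mul h3)))).aestronglyMeasurable
  · exact (((hφ'.integrable_of_hasCompactSupport hφs.deriv).abs.mul_const _).add
      ((hφ.continuous.integrable_of_hasCompactSupport hφs).abs.mul_const _)).restrict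
  · have h1 := abs_windowIntegral_scale_le hψ.continuous hψs (fun y => hM y t) _ (hpos n) (x t)
    have h2 := abs_windowIntegral_scale_le hψ' hψs.deriv (fun y => hN y t) _ (hpos n) (x t)
    have h3 := abs_windowIntegral_scale_le hψ' hψs.deriv (fun y => hM y t) _ (hpos n) (x t)
    have h4 : |1 / ((n : ℝ) + 1)| ≤ 1 := by
      rw [abs_of_pos (by have := hpos n; positivity), div_le_one (hpos n)]
      have : (0 : ℝ) ≤ n := n.cast_nonneg
      linarith
    refine (abs_add_le _ _).trans ?_
    rw [abs_mul, abs_mul (φ t), abs_mul (1 / ((n : ℝ) + 1))]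
    refine add_le_add (mul_le_mul_of_nonneg_left
      (mul_le_mul h4 h1 (abs_nonneg _) zero_le_one) (abs_nonneg _))
      (mul_le_mul_of_nonneg_left ((abs_sub _ _).trans (add_le_add h2 ?_)) (abs_nonneg _))
    rw [abs_mul]
    exact mul_le_mul (norm_deriv_le_of_lipschitz hx) h3 (abs_nonneg _) K.2
  · have hU := hsol.measurable_slice t
    have hl := hlim.left (x t) t ht
    have hr := hlim.right (x t) t ht
    have h1 := tendsto_windowIntegral_scale hψ.continuous hψs hU (fun y => hM y t) hl hr
    have h2 := tendsto_windowIntegral_scale hψ' hψs.deriv (hA.continuous.measurable.comp hU)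
      (fun y => hN y t) ((hA.continuous.tendsto _).comp hl) ((hA.continuous.tendsto _).comp hr)
    have h3 := tendsto_windowIntegral_scale hψ' hψs.deriv hU (fun y => hM y t) hl hr
    have h := (((tendsto_one_div_add_atTop_nhds_zero_nat (𝕜 := ℝ)).mul h1).const_mul
      (deriv φ t)).add ((h2.sub (h3.const_mul (deriv x t))).const_mul (φ t))
    rw [hIic, hIoi] at h
    convert h using 2
    · rfl
    · rw [rankineHugoniotDefect]; ring
  · simp_rw [hweak]
    exact tendsto_const_nhds

theorem ae_rankineHugoniotDefect_eq_zero (hsol : IsEntropySol A U) (hA : ContDiff ℝ (⊤ : ℕ∞) A)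
    (hlim : HasSideLimits U Um Up) {x : ℝ → ℝ} {K : NNReal} (hx : LipschitzWith K x)
    {t₀ T : ℝ} (ht₀ : 0 ≤ t₀) (hT : t₀ < T) :
    ∀ᵐ t, t ∈ Ioo t₀ T → rankineHugoniotDefect A Um Up x t = 0 := by
  obtain ⟨M, hM⟩ := hsol.bounded
  obtain ⟨N, hN⟩ := hsol.exists_flux_bound hA.continuous
  let χ : ContDiffBump ((t₀ + T) / 2) :=
    ⟨(T - t₀) / 4, (T - t₀) / 2, by linarith, by linarith⟩
  have hχsupp : Function.support χ = Ioo t₀ T := by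
    rw [χ.support_eq, Real.ball_eq_Ioo]
    congr 1 <;> simp only [χ] <;> ring
  have hχ0 : ∀ t ≤ 0, χ t = 0 := fun t ht => by
    rw [← Function.notMem_support, hχsupp]
    exact fun h => absurd h.1 (by linarith)
  have hHm : AEStronglyMeasurable (rankineHugoniotDefect A Um Up x) (volume.restrict (Ioi 0)) := by
    obtain ⟨hm, hp⟩ := hlim.aestronglyMeasurable hsol.measurable hx.continuous
    exact ((hA.continuous.comp_aestronglyMeasurable hp).sub
      (hA.continuous.comp_aestronglyMeasurable hm)).sub
      ((measurable_deriv x).aestronglyMeasurable.mul (hp.sub hm))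
  have hHb : ∀ t ∈ Ioi (0 : ℝ), ‖rankineHugoniotDefect A Um Up x t‖ ≤ N + N + K * (M + M) := by
    intro t ht
    obtain ⟨h1, h2⟩ := hlim.abs_le hM (x t) ht
    have h3 : |A (Um (x t) t)| ≤ N := le_of_tendsto
      ((hA.continuous.tendsto _).comp (hlim.left (x t) t ht)).abs
      (Eventually.of_forall fun _ => hN _ _)
    have h4 : |A (Up (x t) t)| ≤ N := le_of_tendsto
      ((hA.continuous.tendsto _).comp (hlim.right (x t) t ht)).abs
      (Eventually.of_forall fun _ => hN _ _)
    refine (norm_sub_le _ _).trans (add_le_add ((norm_sub_le _ _).trans (add_le_add h4 h3)) ?_)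
    rw [norm_mul]
    exact mul_le_mul (norm_deriv_le_of_lipschitz hx)
      ((norm_sub_le _ _).trans (add_le_add h2 h1)) (norm_nonneg _) K.2
  have hint : IntegrableOn (fun t => χ t * rankineHugoniotDefect A Um Up x t) (Ioi 0) :=
    (χ.continuous.integrable_of_hasCompactSupport χ.hasCompactSupport).integrableOn.mul_bdd
      hHm (ae_restrict_of_forall_mem measurableSet_Ioi hHb)
  have hzero : ∀ᵐ t, (Ioi (0 : ℝ)).indicator
      (fun t => χ t * rankineHugoniotDefect A Um Up x t) t = 0 := by
    refine ae_eq_zero_of_integral_contDiff_smul_eq_zero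
      ((integrable_indicator_iff measurableSet_Ioi).2 hint).locallyIntegrable fun g hg hgs => ?_
    obtain ⟨C, hC⟩ := hgs.exists_bound_of_continuous hg.continuous
    have hC0 : 0 ≤ C := (norm_nonneg _).trans (hC 0)
    have h1 := hsol.integral_mul_rankineHugoniotDefect hA hlim (φ := fun t => χ t * (g t + C))
      (χ.contDiff.mul (hg.add contDiff_const)) χ.hasCompactSupport.mul_right
      (fun t => mul_nonneg χ.nonneg (by linarith [neg_le_of_abs_le (hC t)]))
      (fun t ht => by rw [hχ0 t ht, zero_mul]) hx
    have h2 := hsol.integral_mul_rankineHugoniotDefect hA hlim (φ := fun t => χ t * C)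
      (χ.contDiff.mul contDiff_const) χ.hasCompactSupport.mul_right
      (fun t => mul_nonneg χ.nonneg hC0) (fun t ht => by rw [hχ0 t ht, zero_mul]) hx
    have i1 : IntegrableOn (fun t => g t * (χ t * rankineHugoniotDefect A Um Up x t)) (Ioi 0) :=
      hint.bdd_mul hg.continuous.aestronglyMeasurable (ae_of_all _ hC)
    have i2 : IntegrableOn (fun t => C * (χ t * rankineHugoniotDefect A Um Up x t)) (Ioi 0) :=
      hint.const_mul C
    have h3 : ∫ t in Ioi (0 : ℝ), χ t * (g t + C) * rankineHugoniotDefect A Um Up x t =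
        (∫ t in Ioi (0 : ℝ), g t * (χ t * rankineHugoniotDefect A Um Up x t)) +
          ∫ t in Ioi (0 : ℝ), χ t * C * rankineHugoniotDefect A Um Up x t := by
      have h4 : ∀ t, χ t * C * rankineHugoniotDefect A Um Up x t =
        C * (χ t * rankineHugoniotDefect A Um Up x t) := fun t => by ring
      simp_rw [h4]
      rw [← integral_add i1 i2]
      congr 1; ext t; ring
    rw [h1, h2, add_zero] at h3
    refine Eq.trans ?_ h3.symm
    rw [← integral_indicator measurableSet_Ioi]
    congr 1; ext t
    by_cases ht : t ∈ Ioi (0 : ℝ) <;> simp [ht]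
  filter_upwards [hzero] with t ht htI
  rw [indicator_of_mem (mem_Ioi.2 (ht₀.trans_lt htI.1))] at ht
  refine (mul_eq_zero.1 ht).resolve_left ?_
  rwa [← hχsupp] at htI

end IsEntropySol

/-- **Lemma 3.1 (Rankine–Hugoniot along Lipschitz curves).** If `x : [t₀, T] → ℝ` is
Lipschitz, then for a.e. `t ∈ [t₀, T]`,
`A(U(x(t)+, t)) - A(U(x(t)-, t)) - ẋ(t) [U(x(t)+, t) - U(x(t)-, t)] = 0`. -/
theorem rankine_hugoniot_along_curves
    (A : ℝ → ℝ) (hA : ContDiff ℝ (⊤ : ℕ∞) A) (hA'' : ∀ x, 0 < deriv (deriv A) x)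
    (U Um Up : ℝ → ℝ → ℝ)
    (hsol : IsEntropySol A U) (hlim : HasSideLimits U Um Up) (hcont : L1locCont U)
    (t₀ T : ℝ) (ht₀ : 0 ≤ t₀) (hT : t₀ < T)
    (x dx : ℝ → ℝ) (K : NNReal) (hx : LipschitzOnWith K x (Icc t₀ T))
    (hdx : ∀ᵐ t ∂(volume.restrict (Icc t₀ T)), HasDerivAt x (dx t) t) :
    ∀ᵐ t ∂(volume.restrict (Icc t₀ T)),
      A (Up (x t) t) - A (Um (x t) t) - dx t * (Up (x t) t - Um (x t) t) = 0 := by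
  obtain ⟨y, hy, hxy⟩ := hx.extend_real
  have h := hsol.ae_rankineHugoniotDefect_eq_zero hA hlim hy ht₀ hT
  rw [← restrict_Ioo_eq_restrict_Icc] at hdx ⊢
  rw [ae_restrict_iff' measurableSet_Ioo] at hdx ⊢
  filter_upwards [hdx, h] with t hd hzero ht
  have hyd : deriv y t = dx t := by
    have he : y =ᶠ[𝓝 t] x := by
      filter_upwards [Ioo_mem_nhds ht.1 ht.2] with s hs using (hxy (Ioo_subset_Icc_self hs)).symm
    exact he.deriv_eq.trans (hd ht).deriv
  have h0 := hzero ht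
  rwa [rankineHugoniotDefect, hyd, ← hxy (Ioo_subset_Icc_self ht)] at h0
end
end
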